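/- arXiv:2411.19267 — 2 statements merged into one kernel-verified Lean document; each statement's English description precedes it below -/
import Mathlib

section
/- For every integer t with 1 ≤ t ≤ 5 and every real ε > 0 there exists an integer N such that for every integer n ≥ N: (a) every K_3-saturated graph G on n vertices with minimum degree at least t, in which for every pair of distinct twin vertices there is a vertex of degree exactly t adjacent to both of them, satisfies e(G) ≥ (17/3 - ε)·n; and (b) there exists a K_3-saturated graph G on n vertices with minimum degree at least t, in which every pair of distinct twin vertices has a common neighbour of degree exactly t, satisfying e(G) ≤ (6+ε)·n. -/
open SimpleGraph

/-- `G` is `K_r`-saturated: `G` contains no `r`-clique, but adding any missing edge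
creates an `r`-clique. -/
def Ksat (r : ℕ) {V : Type*} (G : SimpleGraph V) : Prop :=
  G.CliqueFree r ∧ ∀ u v : V, u ≠ v → ¬ G.Adj u v →
    ¬ (G ⊔ fromEdgeSet {s(u, v)}).CliqueFree r

/-- `G` is twin-free: distinct vertices have distinct neighbourhoods. -/
def TwinFree {V : Type*} (G : SimpleGraph V) : Prop :=
  ∀ u v : V, G.neighborSet u = G.neighborSet v → u = v

/-- Minimum degree of `G` is at least `t`. -/
def MinDegGe {V : Type*} (G : SimpleGraph V) (t : ℕ) : Prop :=
  ∀ v : V, t ≤ (G.neighborSet v).ncard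

/-- Every pair of distinct twins has a common neighbour of degree exactly `t`. -/
def TwinCond {V : Type*} (G : SimpleGraph V) (t : ℕ) : Prop :=
  ∀ u v : V, u ≠ v → G.neighborSet u = G.neighborSet v →
    ∃ w : V, (G.neighborSet w).ncard = t ∧ G.Adj w u ∧ G.Adj w v

/-- An `(r,t)`-system. -/
def IsRTSystem (r t : ℕ) {V : Type*} [DecidableEq V] (H : SimpleGraph V)
    (F : Finset (Finset V)) : Prop :=
  H.CliqueFree r ∧
  (∀ S ∈ F, S.card = t ∧
    (H.induce (S : Set V)).CliqueFree (r - 1) ∧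
    ∀ v : V, v ∉ S → ¬ (H.induce ((insert v S : Finset V) : Set V)).CliqueFree (r - 1)) ∧
  (∀ S ∈ F, ∀ T ∈ F, S ≠ T → ¬ (H.induce ((S ∩ T : Finset V) : Set V)).CliqueFree (r - 2))

/-- A maximal `(r,t)`-system. -/
def IsMaxRTSystem (r t : ℕ) {V : Type*} [DecidableEq V] (H : SimpleGraph V)
    (F : Finset (Finset V)) : Prop :=
  IsRTSystem r t H F ∧
  ∀ u v : V, u ≠ v → ¬ H.Adj u v →
    ¬ (H ⊔ fromEdgeSet {s(u, v)}).CliqueFree r ∨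
    ∃ S ∈ F, ¬ (((H ⊔ fromEdgeSet {s(u, v)}).induce (S : Set V)).CliqueFree (r - 1))

/-- A `(3,t)`-system. -/
def Is3TSystem (t : ℕ) {V : Type*} [DecidableEq V] (H : SimpleGraph V)
    (F : Finset (Finset V)) : Prop :=
  H.CliqueFree 3 ∧
  (∀ S ∈ F, S.card = t ∧
    (∀ u ∈ S, ∀ v ∈ S, ¬ H.Adj u v) ∧
    (∀ v : V, v ∉ S → ∃ u ∈ S, H.Adj v u)) ∧
  (∀ S ∈ F, ∀ T ∈ F, S ≠ T → (S ∩ T).Nonempty)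

/-- A maximal `(3,t)`-system. -/
def IsMax3TSystem (t : ℕ) {V : Type*} [DecidableEq V] (H : SimpleGraph V)
    (F : Finset (Finset V)) : Prop :=
  Is3TSystem t H F ∧
  ∀ u v : V, u ≠ v → ¬ H.Adj u v →
    ¬ (H ⊔ fromEdgeSet {s(u, v)}).CliqueFree 3 ∨ ∃ S ∈ F, u ∈ S ∧ v ∈ S

noncomputable def s3 (t m : ℕ) : ℕ :=
  sSup {a : ℕ | ∃ (H : SimpleGraph (Fin m)) (F : Finset (Finset (Fin m))),
    Is3TSystem t H F ∧ F.card = a}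

noncomputable def ePrime (r t s : ℕ) : ℕ :=
  sInf {e : ℕ | ∃ (m : ℕ) (H : SimpleGraph (Fin m)) (F : Finset (Finset (Fin m))),
    IsMaxRTSystem r t H F ∧ F.card = s ∧ H.edgeSet.ncard = e}

noncomputable def e3min (t s : ℕ) : ℕ :=
  sInf {e : ℕ | ∃ (m : ℕ) (H : SimpleGraph (Fin m)) (F : Finset (Finset (Fin m))),
    Is3TSystem t H F ∧ F.card = s ∧ H.edgeSet.ncard = e}

section TriangleFree

open scoped Classical
open Finset

variable {V : Type*} (G : SimpleGraph V)

/-- The vertices of `U` that are different from `a` and not adjacent to `a`. -/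
noncomputable def nonNbrs (U : Finset V) (a : V) : Finset V :=
  U.filter fun v => v ≠ a ∧ ¬ G.Adj a v

/-- The number of neighbours of `a` in `U`. -/
noncomputable def degIn (U : Finset V) (a : V) : ℕ := #(U.filter (G.Adj a))

/-- The sum of the degrees of the graph induced on `U`. -/
noncomputable def degSum (U : Finset V) : ℕ := ∑ a ∈ U, degIn G U a

/-- The maximal independent sets with `j` elements of the graph induced on `U`. -/
noncomputable def maxIndep (U : Finset V) (j : ℕ) : Finset (Finset V) :=
  (U.powersetCard j).filter fun R =>
    (∀ u ∈ R, ∀ v ∈ R, ¬ G.Adj u v) ∧ ∀ u ∈ U, u ∉ R → ∃ r ∈ R, G.Adj u r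

/-- The number of maximal independent `j`-sets of `U` containing `a`. -/
noncomputable def maxIndepAt (U : Finset V) (j : ℕ) (a : V) : ℕ :=
  #((maxIndep G U j).filter (a ∈ ·))

/-- No three vertices are pairwise adjacent. -/
def NoTriangle : Prop := ∀ a b c, G.Adj a b → G.Adj a c → ¬ G.Adj b c

variable {G}

theorem mem_maxIndep {U : Finset V} {j : ℕ} {R : Finset V} :
    R ∈ maxIndep G U j ↔ R ⊆ U ∧ #R = j ∧ (∀ u ∈ R, ∀ v ∈ R, ¬ G.Adj u v) ∧
      ∀ u ∈ U, u ∉ R → ∃ r ∈ R, G.Adj u r := by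
  simp [maxIndep, mem_powersetCard, and_assoc]

theorem mem_nonNbrs {U : Finset V} {a v : V} :
    v ∈ nonNbrs G U a ↔ v ∈ U ∧ v ≠ a ∧ ¬ G.Adj a v := by
  simp [nonNbrs]

theorem card_nonNbrs {U : Finset V} {a : V} (ha : a ∈ U) :
    #(nonNbrs G U a) + degIn G U a + 1 = #U := by
  have h : U = insert a (nonNbrs G U a ∪ U.filter (G.Adj a)) := by
    ext v
    simp only [mem_insert, mem_union, mem_nonNbrs, mem_filter]
    by_cases hv : v = a
    · simp [hv, ha]
    · tauto
  have hd : Disjoint (nonNbrs G U a) (U.filter (G.Adj a)) := by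
    rw [Finset.disjoint_left]
    intro v hv hv'
    exact (mem_nonNbrs.1 hv).2.2 (mem_filter.1 hv').2
  have hn : a ∉ nonNbrs G U a ∪ U.filter (G.Adj a) := by
    simp [mem_nonNbrs]
  conv_rhs => rw [h]
  rw [card_insert_of_notMem hn, card_union_of_disjoint hd, degIn]

theorem nonNbrs_subset (U : Finset V) (a : V) : nonNbrs G U a ⊆ U :=
  filter_subset _ _

theorem degIn_mono {U W : Finset V} (h : W ⊆ U) (a : V) : degIn G W a ≤ degIn G U a :=
  card_le_card (filter_subset_filter _ h)

theorem degSum_mono {U W : Finset V} (h : W ⊆ U) : degSum G W ≤ degSum G U :=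
  (sum_le_sum fun a _ => degIn_mono h a).trans
    (sum_le_sum_of_subset h)

/-- Maximal independent sets through `a` correspond to those of the non-neighbours of `a`. -/
theorem maxIndepAt_le (U : Finset V) (j : ℕ) (a : V) :
    maxIndepAt G U (j + 1) a ≤ #(maxIndep G (nonNbrs G U a) j) := by
  refine card_le_card_of_injOn (fun R => R.erase a) ?_ ?_
  · intro R hR
    obtain ⟨hR, ha⟩ := mem_filter.1 hR
    obtain ⟨h1, h2, h3, h4⟩ := mem_maxIndep.1 hR
    refine mem_maxIndep.2 ⟨?_, ?_, ?_, ?_⟩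
    · intro v hv
      have := mem_erase.1 hv
      exact mem_nonNbrs.2 ⟨h1 this.2, this.1, h3 a ha v this.2⟩
    · rw [card_erase_of_mem ha, h2]; rfl
    · intro u hu v hv
      exact h3 u (mem_of_mem_erase hu) v (mem_of_mem_erase hv)
    · intro u hu hu'
      obtain ⟨hu1, hu2, hu3⟩ := mem_nonNbrs.1 hu
      obtain ⟨r, hr, har⟩ := h4 u hu1 fun h => hu' (mem_erase.2 ⟨hu2, h⟩)
      refine ⟨r, mem_erase.2 ⟨?_, hr⟩, har⟩
      rintro rfl
      exact hu3 har.symm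
  · intro R hR R' hR' h
    have ha := (mem_filter.1 hR).2
    have ha' := (mem_filter.1 hR').2
    rw [← insert_erase ha, ← insert_erase ha']
    simp only at h
    rw [h]

theorem sum_maxIndepAt (U : Finset V) (j : ℕ) :
    ∑ a ∈ U, maxIndepAt G U j a = j * #(maxIndep G U j) := by
  have h : ∀ a ∈ U, maxIndepAt G U j a = ∑ R ∈ maxIndep G U j, if a ∈ R then 1 else 0 := by
    intro a _
    rw [maxIndepAt, card_filter]
  rw [sum_congr rfl h, sum_comm, mul_comm, ← smul_eq_mul, ← sum_const]
  refine sum_congr rfl fun R hR => ?_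
  obtain ⟨h1, h2, -⟩ := mem_maxIndep.1 hR
  rw [← card_filter, ← h2]
  congr 1
  ext v
  simp only [mem_filter]
  exact ⟨fun h => h.2, fun h => ⟨h1 h, h⟩⟩

theorem card_le_sum_degIn {U : Finset V} {j : ℕ} {R : Finset V} (hR : R ∈ maxIndep G U j) :
    #U ≤ j + ∑ a ∈ R, degIn G U a := by
  obtain ⟨h1, h2, -, h4⟩ := mem_maxIndep.1 hR
  have : U ⊆ R ∪ R.biUnion fun a => U.filter (G.Adj a) := by
    intro u hu
    by_cases h : u ∈ R
    · exact mem_union_left _ h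
    · obtain ⟨r, hr, har⟩ := h4 u hu h
      exact mem_union_right _ (mem_biUnion.2 ⟨r, hr, mem_filter.2 ⟨hu, har.symm⟩⟩)
  calc #U ≤ _ := card_le_card this
    _ ≤ _ := card_union_le _ _
    _ ≤ _ := by
      rw [h2]
      exact Nat.add_le_add_left card_biUnion_le _

theorem mul_card_le_sum_mul_degIn (U : Finset V) (j : ℕ) :
    #(maxIndep G U j) * #U ≤
      #(maxIndep G U j) * j + ∑ a ∈ U, maxIndepAt G U j a * degIn G U a := by
  have h1 : ∑ a ∈ U, maxIndepAt G U j a * degIn G U a =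
      ∑ R ∈ maxIndep G U j, ∑ a ∈ R, degIn G U a := by
    have : ∀ R ∈ maxIndep G U j, ∑ a ∈ R, degIn G U a =
        ∑ a ∈ U, if a ∈ R then degIn G U a else 0 := by
      intro R hR
      rw [← sum_filter]
      refine sum_congr ?_ fun _ _ => rfl
      ext v
      simp only [mem_filter]
      exact ⟨fun h => ⟨(mem_maxIndep.1 hR).1 h, h⟩, fun h => h.2⟩
    rw [sum_congr rfl this, sum_comm]
    refine sum_congr rfl fun a _ => ?_
    rw [← sum_filter, sum_const, smul_eq_mul, maxIndepAt]
  rw [h1, ← smul_eq_mul, ← smul_eq_mul, ← sum_const, ← sum_const, ← sum_add_distrib]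
  exact sum_le_sum fun R hR => card_le_sum_degIn hR

theorem card_maxIndep_zero (U : Finset V) : #(maxIndep G U 0) ≤ 1 := by
  refine (card_filter_le _ _).trans ?_
  simp

theorem card_maxIndep_one (h : NoTriangle G) (U : Finset V) : #(maxIndep G U 1) ≤ 2 := by
  by_contra! hc
  obtain ⟨A, hA, B, hB, C, hC, hAB, hAC, hBC⟩ := two_lt_card.1 hc
  obtain ⟨hA1, hA2, hA3, hA4⟩ := mem_maxIndep.1 hA
  obtain ⟨hB1, hB2, hB3, hB4⟩ := mem_maxIndep.1 hB
  obtain ⟨hC1, hC2, hC3, hC4⟩ := mem_maxIndep.1 hC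
  obtain ⟨x, rfl⟩ := card_eq_one.1 hA2
  obtain ⟨y, rfl⟩ := card_eq_one.1 hB2
  obtain ⟨z, rfl⟩ := card_eq_one.1 hC2
  simp only [singleton_subset_iff, mem_singleton, exists_eq_left, ne_eq, singleton_inj] at *
  exact h x y z (hB4 x hA1 hAB) (hC4 x hA1 hAC) (hC4 y hB1 hBC)

theorem card_maxIndep_two_le (h : NoTriangle G) (U : Finset V) : #(maxIndep G U 2) ≤ #U := by
  have h1 := sum_maxIndepAt (G := G) U 2
  have h2 : ∑ a ∈ U, maxIndepAt G U 2 a ≤ ∑ a ∈ U, 2 :=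
    sum_le_sum fun a _ => (maxIndepAt_le U 1 a).trans (card_maxIndep_one h _)
  rw [sum_const, smul_eq_mul] at h2
  lia

theorem card_maxIndep_two_mul_le (h : NoTriangle G) (U : Finset V) :
    #(maxIndep G U 2) * #U ≤ #(maxIndep G U 2) * 2 + 2 * degSum G U := by
  refine (mul_card_le_sum_mul_degIn U 2).trans (Nat.add_le_add_left ?_ _)
  rw [degSum, mul_sum]
  exact sum_le_sum fun a _ =>
    Nat.mul_le_mul_right _ ((maxIndepAt_le U 1 a).trans (card_maxIndep_one h _))

end TriangleFree

section Triples

open scoped Classical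
open Finset

variable {V : Type*} {G : SimpleGraph V}

theorem card_maxIndep_le_two_pow (h : NoTriangle G) (U : Finset V) (j : ℕ) (a : V) :
    #(maxIndep G U j) ≤ 2 ^ (#(nonNbrs G U a) + 1) := by
  have key : #(maxIndep G U j) ≤ #(insert a (nonNbrs G U a)).powerset := by
    refine card_le_card_of_injOn (fun R => R ∩ insert a (nonNbrs G U a)) ?_ ?_
    · intro R _
      exact mem_powerset.2 inter_subset_right
    · have aux : ∀ R ∈ maxIndep G U j, ∀ R' ∈ maxIndep G U j,
          R ∩ insert a (nonNbrs G U a) = R' ∩ insert a (nonNbrs G U a) → R ⊆ R' := by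
        intro R hR R' hR' hRR v hv
        obtain ⟨h1, -, h3, -⟩ := mem_maxIndep.1 hR
        obtain ⟨-, -, -, h4⟩ := mem_maxIndep.1 hR'
        by_contra hv'
        obtain ⟨r, hr, hvr⟩ := h4 v (h1 hv) hv'
        have hmem : ∀ w, (w ∈ R ∧ (w = a ∨ w ∈ nonNbrs G U a)) ↔
            (w ∈ R' ∧ (w = a ∨ w ∈ nonNbrs G U a)) := by
          intro w
          simpa using (Finset.ext_iff.1 hRR) w
        have hv1 := hmem v
        have hr1 := hmem r
        have hrU : r ∈ U := (mem_maxIndep.1 hR').1 hr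
        simp only [mem_nonNbrs] at hv1 hr1
        have hvU := h1 hv
        have h5 : G.Adj a v := by grind
        have h6 : ¬ G.Adj a r := fun h' => h a v r h5 h' hvr
        exact h3 v hv r (by grind) hvr
      intro R hR R' hR' hRR
      exact (aux R hR R' hR' hRR).antisymm (aux R' hR' R hR hRR.symm)
  rw [card_powerset] at key
  exact key.trans (Nat.pow_le_pow_right (by norm_num) (card_insert_le _ _))

variable (G) in
/-- `{p, q}` is a maximal independent pair of `Q`. -/
def MaxPair (Q : Finset V) (p q : V) : Prop :=
  p ∈ Q ∧ q ∈ Q ∧ p ≠ q ∧ ¬ G.Adj p q ∧ ∀ v ∈ Q, v ≠ p → v ≠ q → G.Adj v p ∨ G.Adj v q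

variable (G) in
/-- `{p, q, r}` is a maximal independent triple of `U`. -/
def MaxTriple (U : Finset V) (p q r : V) : Prop :=
  (p ∈ U ∧ q ∈ U ∧ r ∈ U) ∧ (p ≠ q ∧ p ≠ r ∧ q ≠ r) ∧
    (¬ G.Adj p q ∧ ¬ G.Adj p r ∧ ¬ G.Adj q r) ∧
    ∀ v ∈ U, v ≠ p → v ≠ q → v ≠ r → G.Adj v p ∨ G.Adj v q ∨ G.Adj v r

theorem mem_maxIndep_two {Q R : Finset V} :
    R ∈ maxIndep G Q 2 ↔ ∃ p q, R = {p, q} ∧ MaxPair G Q p q := by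
  rw [mem_maxIndep]
  constructor
  · rintro ⟨h1, h2, h3, h4⟩
    obtain ⟨p, q, hpq, rfl⟩ := card_eq_two.1 h2
    refine ⟨p, q, rfl, h1 (by simp), h1 (by simp), hpq, h3 _ (by simp) _ (by simp), ?_⟩
    intro v hv h5 h6
    simpa using h4 v hv (by simp [h5, h6])
  · rintro ⟨p, q, rfl, h1, h2, h3, h4, h5⟩
    have h4' : ¬ G.Adj q p := fun h => h4 h.symm
    refine ⟨by simp [insert_subset_iff, h1, h2], card_pair h3, by simp [h4, h4'], ?_⟩
    intro v hv hv'
    simp only [mem_insert, mem_singleton, not_or] at hv'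
    simpa using h5 v hv hv'.1 hv'.2

theorem mem_maxIndep_three {U R : Finset V} :
    R ∈ maxIndep G U 3 ↔ ∃ p q r, R = {p, q, r} ∧ MaxTriple G U p q r := by
  rw [mem_maxIndep]
  constructor
  · rintro ⟨h1, h2, h3, h4⟩
    obtain ⟨p, q, r, hpq, hpr, hqr, rfl⟩ := card_eq_three.1 h2
    refine ⟨p, q, r, rfl, ⟨h1 (by simp), h1 (by simp), h1 (by simp)⟩, ⟨hpq, hpr, hqr⟩,
      ⟨h3 _ (by simp) _ (by simp), h3 _ (by simp) _ (by simp), h3 _ (by simp) _ (by simp)⟩, ?_⟩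
    intro v hv h5 h6 h7
    simpa using h4 v hv (by simp [h5, h6, h7])
  · rintro ⟨p, q, r, rfl, ⟨h1, h2, h3⟩, ⟨h4, h5, h6⟩, ⟨h7, h8, h9⟩, h10⟩
    refine ⟨by simp [insert_subset_iff, h1, h2, h3], card_eq_three.2 ⟨p, q, r, h4, h5, h6, rfl⟩,
      by simp [h7, h8, h9, G.adj_comm q p, G.adj_comm r p, G.adj_comm r q], ?_⟩
    intro v hv hv'
    simp only [mem_insert, mem_singleton, not_or] at hv'
    simpa using h10 v hv hv'.1 hv'.2.1 hv'.2.2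

theorem MaxPair.symm {Q : Finset V} {p q : V} (h : MaxPair G Q p q) : MaxPair G Q q p := by
  obtain ⟨h1, h2, h3, h4, h5⟩ := h
  exact ⟨h2, h1, h3.symm, fun h => h4 h.symm, fun v hv a b => (h5 v hv b a).symm⟩

theorem MaxPair.adj {Q : Finset V} {p q q' : V} (h : MaxPair G Q p q) (h' : MaxPair G Q p q')
    (hq : q ≠ q') : G.Adj q q' := by
  obtain ⟨h1, h2, h3, h4, h5⟩ := h
  obtain ⟨h1', h2', h3', h4', h5'⟩ := h'
  rcases h5' q h2 h3.symm hq with h | h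
  · exact absurd h.symm h4
  · exact h

theorem MaxTriple.swap {U : Finset V} {p q r : V} (h : MaxTriple G U p q r) :
    MaxTriple G U q p r := by
  obtain ⟨⟨h1, h2, h3⟩, ⟨h4, h5, h6⟩, ⟨h7, h8, h9⟩, h10⟩ := h
  refine ⟨⟨h2, h1, h3⟩, ⟨h4.symm, h6, h5⟩, ⟨fun h => h7 h.symm, h9, h8⟩, fun v hv a b c => ?_⟩
  have := h10 v hv b a c
  tauto

theorem MaxTriple.rotate {U : Finset V} {p q r : V} (h : MaxTriple G U p q r) :
    MaxTriple G U q r p := by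
  obtain ⟨⟨h1, h2, h3⟩, ⟨h4, h5, h6⟩, ⟨h7, h8, h9⟩, h10⟩ := h
  refine ⟨⟨h2, h3, h1⟩, ⟨h6, h4.symm, h5.symm⟩,
    ⟨h9, fun h => h7 h.symm, fun h => h8 h.symm⟩, fun v hv a b c => ?_⟩
  have := h10 v hv c a b
  tauto

theorem MaxTriple.adj {U : Finset V} {p q r r' : V} (h : MaxTriple G U p q r)
    (h' : MaxTriple G U p q r') (hr : r ≠ r') : G.Adj r r' := by
  obtain ⟨⟨h1, h2, h3⟩, ⟨h4, h5, h6⟩, ⟨h7, h8, h9⟩, h10⟩ := h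
  obtain ⟨-, -, -, h10'⟩ := h'
  rcases h10' r h3 h5.symm h6.symm hr with h | h | h
  · exact absurd h.symm h8
  · exact absurd h.symm h9
  · exact h

theorem exists_maxPair_notMem {Q : Finset V} (h4 : 4 ≤ #(maxIndep G Q 2)) (A B C : Finset V) :
    ∃ p q, MaxPair G Q p q ∧ ({p, q} : Finset V) ≠ A ∧ ({p, q} : Finset V) ≠ B ∧
      ({p, q} : Finset V) ≠ C := by
  have h3 : #({A, B, C} : Finset (Finset V)) < #(maxIndep G Q 2) :=
    lt_of_le_of_lt card_le_three (by lia)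
  obtain ⟨R, hR, hR'⟩ := exists_mem_notMem_of_card_lt_card h3
  obtain ⟨p, q, rfl, hp⟩ := mem_maxIndep_two.1 hR
  simp only [mem_insert, mem_singleton, not_or] at hR'
  exact ⟨p, q, hp, hR'⟩

/-- A set with many maximal independent pairs has no path of length two joining such a pair. -/
theorem MaxPair.no_common_adj (h : NoTriangle G) {Q : Finset V} (h4 : 4 ≤ #(maxIndep G Q 2))
    (h7 : 7 ≤ #Q) {u w : V} (huw : MaxPair G Q u w) {c : V} (hc : c ∈ Q) (hcu : G.Adj c u)
    (hcw : G.Adj c w) : False := by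
  have big : ∀ p q r s t : V, ∃ z ∈ Q, z ≠ p ∧ z ≠ q ∧ z ≠ r ∧ z ≠ s ∧ z ≠ t := by
    intro p q r s t
    have h3 : #({p, q, r, s, t} : Finset V) < #Q := lt_of_le_of_lt card_le_five (by lia)
    obtain ⟨z, hz, hz'⟩ := exists_mem_notMem_of_card_lt_card h3
    simp only [mem_insert, mem_singleton, not_or] at hz'
    exact ⟨z, hz, hz'⟩
  have big2 : ∀ p q r s t t' : V, ∃ z ∈ Q, z ≠ p ∧ z ≠ q ∧ z ≠ r ∧ z ≠ s ∧ z ≠ t ∧ z ≠ t' := by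
    intro p q r s t t'
    have h3 : #({p, q, r, s, t, t'} : Finset V) < #Q := lt_of_le_of_lt card_le_six (by lia)
    obtain ⟨z, hz, hz'⟩ := exists_mem_notMem_of_card_lt_card h3
    simp only [mem_insert, mem_singleton, not_or] at hz'
    exact ⟨z, hz, hz'⟩
  have hNc : ∀ v ∈ Q, G.Adj c v → v = u ∨ v = w := by
    intro v hv hcv
    by_contra! hne
    rcases huw.2.2.2.2 v hv hne.1 hne.2 with h' | h'
    · exact h c v u hcv hcu h'
    · exact h c v w hcv hcw h'
  have hcover : ∀ p q, MaxPair G Q p q → p = c ∨ q = c ∨ p = u ∨ p = w ∨ q = u ∨ q = w := by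
    intro p q hpq
    by_contra! hne
    rcases hpq.2.2.2.2 c hc (by grind) (by grind) with h' | h'
    · have := hNc p hpq.1 h'; grind
    · have := hNc q hpq.2.1 h'; grind
  have hcuni : ∀ d d', MaxPair G Q c d → MaxPair G Q c d' → d = d' := by
    intro d d' hd hd'
    by_contra hne
    have hdd := hd.adj hd' hne
    obtain ⟨z, hz, h1, h2, h3, h5, h6⟩ := big c u w d d'
    have h8 : ¬ G.Adj z c := fun h' => by have := hNc z hz h'.symm; grind
    have h9 := (hd.2.2.2.2 z hz h1 h5).resolve_left h8
    have h10 := (hd'.2.2.2.2 z hz h1 h6).resolve_left h8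
    exact h z d d' h9 h10 hdd
  have huni : ∀ u w w' w'', MaxPair G Q u w → MaxPair G Q u w' → MaxPair G Q u w'' →
      w ≠ w' → w ≠ w'' → w' = w'' := by
    intro u w w' w'' h1 h2 h3 h5 h6
    by_contra h8
    exact h w w' w'' (h1.adj h2 h5) (h1.adj h3 h6) (h2.adj h3 h8)
  have key : ∀ d w' u', MaxPair G Q c d → MaxPair G Q u w' → MaxPair G Q w u' → w' ≠ w → u' ≠ u →
      False := by
    intro d w' u' hd hw' hu' h1 h2
    obtain ⟨z, hz, h3⟩ := big2 u w w' u' c d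
    have hzc : ¬ G.Adj z c := fun h' => by have := hNc z hz h'.symm; grind
    have hzd : G.Adj z d := (hd.2.2.2.2 z hz (by grind) (by grind)).resolve_left hzc
    have e1 := huw.adj hw' h1.symm
    have e2 := huw.symm.adj hu' h2.symm
    have f1 := huw.2.2.2.2 z hz (by grind) (by grind)
    have f2 := hw'.2.2.2.2 z hz (by grind) (by grind)
    have f3 := hu'.2.2.2.2 z hz (by grind) (by grind)
    have zu : G.Adj z u := by
      by_contra hzu
      exact h z w w' (f1.resolve_left hzu) (f2.resolve_left hzu) e1
    have zw : G.Adj z w := by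
      by_contra hzw
      exact h z u u' (f1.resolve_right hzw) (f3.resolve_left hzw) e2
    have hdu : d ≠ u := by rintro rfl; exact hd.2.2.2.1 hcu
    have hdw : d ≠ w := by rintro rfl; exact hd.2.2.2.1 hcw
    rcases huw.2.2.2.2 d hd.2.1 hdu hdw with h' | h'
    · exact h z d u hzd zu h'
    · exact h z d w hzd zw h'
  have hsymm : ∀ p q, MaxPair G Q p q → MaxPair G Q q p := fun p q h => h.symm
  have hpc : ∀ p q : V, ({p, q} : Finset V) = {q, p} := fun p q => pair_comm p q
  have hcu' : ¬ MaxPair G Q c u := fun h' => h'.2.2.2.1 hcu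
  have hcw' : ¬ MaxPair G Q c w := fun h' => h'.2.2.2.1 hcw
  by_cases hd : ∃ d, MaxPair G Q c d
  · obtain ⟨d, hd⟩ := hd
    by_cases hw : ∃ w', MaxPair G Q u w' ∧ w' ≠ w
    · obtain ⟨w', hw', hww⟩ := hw
      obtain ⟨p, q, hpq, h1, h2, h3⟩ := exists_maxPair_notMem h4 {u, w} {u, w'} {c, d}
      have := key d w' 
      grind
    · by_cases hu : ∃ u', MaxPair G Q w u' ∧ u' ≠ u
      · obtain ⟨u', hu', huu⟩ := hu
        obtain ⟨p, q, hpq, h1, h2, h3⟩ := exists_maxPair_notMem h4 {u, w} {w, u'} {c, d}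
        grind
      · obtain ⟨p, q, hpq, h1, h2, h3⟩ := exists_maxPair_notMem h4 {u, w} {c, d} {c, d}
        grind
  · obtain ⟨w', hw'⟩ : ∃ w', ∀ w'', MaxPair G Q u w'' → w'' = w ∨ w'' = w' := by
      by_cases hw : ∃ w', MaxPair G Q u w' ∧ w' ≠ w
      · obtain ⟨w', hw', hww⟩ := hw
        exact ⟨w', by grind⟩
      · exact ⟨w, by grind⟩
    obtain ⟨u', hu'⟩ : ∃ u', ∀ w'', MaxPair G Q w w'' → w'' = u ∨ w'' = u' := by
      by_cases hw : ∃ w', MaxPair G Q w w' ∧ w' ≠ u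
      · obtain ⟨w', hw', hww⟩ := hw
        exact ⟨w', by grind⟩
      · exact ⟨u, by grind⟩
    obtain ⟨p, q, hpq, h1, h2, h3⟩ := exists_maxPair_notMem h4 {u, w} {u, w'} {w, u'}
    grind

end Triples

section Split

open scoped Classical
open Finset

variable {V : Type*} {G : SimpleGraph V}

/-- If a maximal independent pair lies within a part `X` of a bipartition arising from another pair
`u, w`, then there are few maximal pairs. -/
theorem MaxPair.not_same_side (h : NoTriangle G) {Q : Finset V} (h4 : 4 ≤ #(maxIndep G Q 2))
    (h7 : 7 ≤ #Q) {u w : V} (huw : MaxPair G Q u w) (hno : ∀ c ∈ Q, G.Adj c u → ¬ G.Adj c w)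
    {p q : V} (hpq : MaxPair G Q p q) (hp : p = u ∨ G.Adj p w) (hq : q = u ∨ G.Adj q w) :
    False := by
  have main : ∀ x, MaxPair G Q u x → G.Adj x w → False := by
    intro x hx hxw
    have hX : ∀ v ∈ Q, G.Adj v w → v = x := by
      intro v hv hvw
      by_contra hne
      have hvu : v ≠ u := by rintro rfl; exact huw.2.2.2.1 hvw
      rcases hx.2.2.2.2 v hv hvu hne with h' | h'
      · exact hno v hv h' hvw
      · exact h v x w h' hvw hxw
    obtain ⟨p', q', hpq', h1, h2, h3⟩ := exists_maxPair_notMem h4 {u, w} {u, x}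
      (if hy : ∃ y, MaxPair G Q x y ∧ y ≠ u then {x, hy.choose} else ∅)
    have hsymm : ∀ p q, MaxPair G Q p q → MaxPair G Q q p := fun p q h => h.symm
    have hpc : ∀ p q : V, ({p, q} : Finset V) = {q, p} := fun p q => pair_comm p q
    have hw2 : ∀ w', MaxPair G Q w w' → w' = u := by
      intro w' hw'
      by_contra hne
      have e := huw.symm.adj hw' (Ne.symm hne)
      have hQ : Q ⊆ {u, x, w, w'} := by
        intro v hv
        by_contra hv'
        simp only [mem_insert, mem_singleton, not_or] at hv'
        have hvw : ¬ G.Adj v w := fun h' => hv'.2.1 (hX v hv h')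
        rcases hw'.2.2.2.2 v hv hv'.2.2.1 hv'.2.2.2 with h' | h'
        · exact hvw h'
        · rcases huw.2.2.2.2 v hv hv'.1 hv'.2.2.1 with h'' | h''
          · exact h v u w' h'' h' e
          · exact hvw h''
      have := (card_le_card hQ).trans card_le_four
      lia
    have hxy : ∀ y, MaxPair G Q x y → y ≠ u → ({x, y} : Finset V) =
        (if hy : ∃ y, MaxPair G Q x y ∧ y ≠ u then {x, hy.choose} else ∅) := by
      intro y hy hyu
      have hex : ∃ y, MaxPair G Q x y ∧ y ≠ u := ⟨y, hy, hyu⟩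
      rw [dif_pos hex]
      by_contra hne
      obtain ⟨hc1, hc2⟩ := hex.choose_spec
      have hyy : y ≠ hex.choose := fun h' => hne (by rw [← h'])
      exact h _ _ _ (hx.symm.adj hy hyu.symm) (hx.symm.adj hc1 hc2.symm) (hy.adj hc1 hyy)
    have hdom : p' = w ∨ q' = w ∨ p' = x ∨ q' = x := by
      by_contra! hne
      rcases hpq'.2.2.2.2 w huw.2.1 hne.1.symm hne.2.1.symm with h' | h'
      · exact hne.2.2.1 (hX _ hpq'.1 h'.symm)
      · exact hne.2.2.2 (hX _ hpq'.2.1 h'.symm)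
    rcases hdom with rfl | rfl | rfl | rfl
    · have := hw2 q' hpq'; subst this; exact h1 (hpc _ _)
    · have := hw2 p' hpq'.symm; subst this; exact h1 rfl
    · by_cases hq' : q' = u
      · subst hq'; exact h2 (hpc _ _)
      · exact h3 (hxy q' hpq' hq')
    · by_cases hq' : p' = u
      · subst hq'; exact h2 rfl
      · exact h3 ((hpc _ _).trans (hxy p' hpq'.symm hq'))
  by_cases hpu : p = u
  · subst hpu
    rcases hq with rfl | hq
    · exact hpq.2.2.1 rfl
    · exact main q hpq hq
  · by_cases hqu : q = u
    · subst hqu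
      exact main p hpq.symm (hp.resolve_left hpu)
    · have hpw := hp.resolve_left hpu
      have hqw := hq.resolve_left hqu
      rcases hpq.2.2.2.2 u huw.1 (Ne.symm hpu) (Ne.symm hqu) with h' | h'
      · exact hno p hpq.1 h'.symm hpw
      · exact hno q hpq.2.1 h'.symm hqw

/-- A set with many maximal independent pairs splits into two independent sides, each pair crossing
between the sides. -/
theorem exists_bipartition (h : NoTriangle G) {Q : Finset V} (h4 : 4 ≤ #(maxIndep G Q 2))
    (h7 : 7 ≤ #Q) : ∃ X Y : Finset V, Q = X ∪ Y ∧ Disjoint X Y ∧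
      (∀ u ∈ X, ∀ v ∈ X, ¬ G.Adj u v) ∧ (∀ u ∈ Y, ∀ v ∈ Y, ¬ G.Adj u v) ∧
      ∀ p q, MaxPair G Q p q → p ∈ X ∧ q ∈ Y ∨ p ∈ Y ∧ q ∈ X := by
  obtain ⟨u, w, huw, -⟩ := exists_maxPair_notMem h4 ∅ ∅ ∅
  have hno : ∀ c ∈ Q, G.Adj c u → ¬ G.Adj c w :=
    fun c hc h1 h2 => huw.no_common_adj h h4 h7 hc h1 h2
  obtain ⟨g1, g2, g3, g4, g5⟩ := id huw
  have g4' : ¬ G.Adj w u := fun h' => g4 h'.symm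
  have hsym : ∀ a b, G.Adj a b → G.Adj b a := fun a b h => h.symm
  refine ⟨Q.filter fun v => v = u ∨ G.Adj v w, Q.filter fun v => v = w ∨ G.Adj v u,
    ?_, ?_, ?_, ?_, ?_⟩
  · ext v
    simp only [mem_union, mem_filter]
    have := g5 v
    tauto
  · rw [Finset.disjoint_left]
    intro v hv hv'
    simp only [mem_filter] at hv hv'
    have := hno v hv.1
    rcases hv.2 with rfl | hv2 <;> rcases hv'.2 with rfl | hv2'
    · exact g3 rfl
    · exact G.irrefl hv2'
    · exact G.irrefl hv2
    · exact this hv2' hv2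
  · intro a ha b hb hab
    simp only [mem_filter] at ha hb
    rcases ha.2 with rfl | ha2 <;> rcases hb.2 with rfl | hb2
    · exact G.irrefl hab
    · exact hno b hb.1 hab.symm hb2
    · exact hno a ha.1 hab ha2
    · exact h a b w hab ha2 hb2
  · intro a ha b hb hab
    simp only [mem_filter] at ha hb
    rcases ha.2 with rfl | ha2 <;> rcases hb.2 with rfl | hb2
    · exact G.irrefl hab
    · exact hno b hb.1 hb2 hab.symm
    · exact hno a ha.1 ha2 hab
    · exact h a b u hab ha2 hb2
  · intro p q hpq
    have hno' : ∀ c ∈ Q, G.Adj c w → ¬ G.Adj c u := fun c hc h1 h2 => hno c hc h2 h1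
    have n1 := MaxPair.not_same_side h h4 h7 huw hno hpq
    have n2 := MaxPair.not_same_side h h4 h7 huw.symm hno' hpq
    have cp := g5 p hpq.1
    have cq := g5 q hpq.2.1
    have hp := hpq.1
    have hq := hpq.2.1
    simp only [mem_filter, hp, hq, true_and]
    tauto

end Split

section Crossing

open scoped Classical
open Finset

variable {V : Type*} {G : SimpleGraph V}

theorem MaxTriple.false_of_three (h : NoTriangle G) {U : Finset V} {p q r₁ r₂ r₃ : V}
    (h₁ : MaxTriple G U p q r₁) (h₂ : MaxTriple G U p q r₂) (h₃ : MaxTriple G U p q r₃)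
    (h₁₂ : r₁ ≠ r₂) (h₁₃ : r₁ ≠ r₃) (h₂₃ : r₂ ≠ r₃) : False :=
  h r₁ r₂ r₃ (h₁.adj h₂ h₁₂) (h₁.adj h₃ h₁₃) (h₂.adj h₃ h₂₃)

variable (G) in
/-- `c` lies in `A` and forms a maximal independent triple with two vertices of `B`. -/
def IsCentre (U : Finset V) (A B : V → Prop) (c : V) : Prop :=
  A c ∧ ∃ r r', B r ∧ B r' ∧ MaxTriple G U c r r'

variable (G) in
/-- `x, y, z` is a maximal independent triple with one vertex in each of `A`, `B`, `C`. -/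
def CrossTriple (U : Finset V) (A B C : V → Prop) (x y z : V) : Prop :=
  A x ∧ B y ∧ C z ∧ MaxTriple G U x y z

theorem CrossTriple.swap {U : Finset V} {A B C : V → Prop} {x y z : V}
    (h : CrossTriple G U A B C x y z) : CrossTriple G U B A C y x z :=
  ⟨h.2.1, h.1, h.2.2.1, h.2.2.2.swap⟩

theorem CrossTriple.rotate {U : Finset V} {A B C : V → Prop} {x y z : V}
    (h : CrossTriple G U A B C x y z) : CrossTriple G U B C A y z x :=
  ⟨h.2.1, h.2.2.1, h.1, h.2.2.2.rotate⟩

variable (G) in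
/-- Three pairwise disjoint independent classes of vertices. -/
structure IndepClasses (A B C : V → Prop) : Prop where
  indep₁ : ∀ u v, A u → A v → ¬ G.Adj u v
  indep₂ : ∀ u v, B u → B v → ¬ G.Adj u v
  indep₃ : ∀ u v, C u → C v → ¬ G.Adj u v
  disj₁₂ : ∀ v, A v → ¬ B v
  disj₁₃ : ∀ v, A v → ¬ C v
  disj₂₃ : ∀ v, B v → ¬ C v

variable {U : Finset V} {A B C : V → Prop}

theorem IndepClasses.swap (h : IndepClasses G A B C) : IndepClasses G B A C :=
  ⟨h.2, h.1, h.3, fun v a b => h.4 v b a, h.6, h.5⟩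

theorem IndepClasses.rotate (h : IndepClasses G A B C) : IndepClasses G B C A :=
  ⟨h.2, h.3, h.1, h.6, fun v a b => h.4 v b a, fun v a b => h.5 v b a⟩

theorem CrossTriple.adj (hI : IndepClasses G A B C) {x y z y' z' : V}
    (h : CrossTriple G U A B C x y z) (h' : CrossTriple G U A B C x y' z')
    (hne : y' ≠ y ∨ z' ≠ z) : G.Adj y' z ∧ G.Adj y z' := by
  have hy : y' ≠ y := by
    rintro rfl
    exact hI.indep₃ z z' h.2.2.1 h'.2.2.1 (h.2.2.2.adj h'.2.2.2 (by tauto))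
  have hz : z' ≠ z := by
    rintro rfl
    exact hI.indep₂ y y' h.2.1 h'.2.1
      (h.2.2.2.rotate.rotate.swap.rotate.rotate.swap.rotate.rotate.swap.adj
      h'.2.2.2.rotate.rotate.swap.rotate.rotate.swap.rotate.rotate.swap hy.symm)
  obtain ⟨hx, hy1, hz1, ⟨⟨i1, i2, i3⟩, ⟨i4, i5, i6⟩, ⟨i7, i8, i9⟩, i10⟩⟩ := h
  obtain ⟨hx', hy1', hz1', ⟨⟨j1, j2, j3⟩, ⟨j4, j5, j6⟩, ⟨j7, j8, j9⟩, j10⟩⟩ := h'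
  have n1 := hI.indep₂ y y' hy1 hy1'
  have n2 := hI.indep₂ y' y hy1' hy1
  have hsym : ∀ a b, G.Adj a b → G.Adj b a := fun a b h => h.symm
  have n3 := hI.disj₂₃
  refine ⟨?_, ?_⟩
  · have := i10 y' j2 j4.symm hy (by grind)
    grind
  · have := j10 y i2 i4.symm hy.symm (by grind)
    grind

/-- Not all three vertices of a crossing triple lie in further crossing triples. -/
theorem CrossTriple.false_of_shared (h : NoTriangle G) (hI : IndepClasses G A B C)
    {x y z y' z' x₂ y₂ x₃ z₃ : V} (h₀ : CrossTriple G U A B C x y z)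
    (h₁ : CrossTriple G U A B C x y' z') (hne₁ : y' ≠ y ∨ z' ≠ z)
    (h₂ : CrossTriple G U A B C x₂ y₂ z) (hne₂ : x₂ ≠ x ∨ y₂ ≠ y)
    (h₃ : CrossTriple G U A B C x₃ y z₃) (hne₃ : x₃ ≠ x ∨ z₃ ≠ z) : False := by
  obtain ⟨a1, a2⟩ := h₀.adj hI h₁ hne₁
  obtain ⟨b1, b2⟩ := h₀.rotate.rotate.adj hI.rotate.rotate h₂.rotate.rotate hne₂
  obtain ⟨c1, c2⟩ := h₀.rotate.adj hI.rotate h₃.rotate (by tauto)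
  have hsym : ∀ a b, G.Adj a b → G.Adj b a := fun a b h => h.symm
  have irr : ∀ a, ¬ G.Adj a a := fun a => G.irrefl
  obtain ⟨k1, k2, k3, k4, k5, k6⟩ := hI
  obtain ⟨p1, p2, p3, ⟨⟨i1, i2, i3⟩, ⟨i4, i5, i6⟩, ⟨i7, i8, i9⟩, i10⟩⟩ := h₀
  obtain ⟨q1, q2, q3, ⟨⟨j1, j2, j3⟩, -, ⟨j7, j8, j9⟩, j10⟩⟩ := h₁
  obtain ⟨r1, r2, r3, ⟨⟨l1, l2, l3⟩, -, ⟨l7, l8, l9⟩, l10⟩⟩ := h₂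
  obtain ⟨s1, s2, s3, ⟨⟨m1, m2, m3⟩, -, ⟨m7, m8, m9⟩, m10⟩⟩ := h₃
  have e1 : G.Adj x₂ y' := by
    have := j10 x₂ l1 (by grind) (by grind) (by grind)
    rcases this with t | t | t
    · exact absurd t (k1 _ _ r1 p1)
    · exact t
    · exact absurd t (fun t => h x₂ y z' b1 t a2)
  have e2 : G.Adj y' z₃ := by
    have := m10 y' j2 (by grind) (by grind) (by grind)
    rcases this with t | t | t
    · exact absurd t (fun t => h y' z x₃ a1 t c2)
    · exact absurd t (k2 _ _ q2 p2)
    · exact t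
  have e3 : G.Adj z₃ x₂ := by
    have := l10 z₃ m3 (by grind) (by grind) (by grind)
    rcases this with t | t | t
    · exact t
    · exact absurd t (fun t => h z₃ x y₂ c1 t b2)
    · exact absurd t (k3 _ _ s3 p3)
  exact h y' z₃ x₂ e2 e1.symm e3

/-- If `x` is a centre, then `y` lies in no other crossing triple and is not a centre. -/
theorem CrossTriple.eq_of_isCentre (h : NoTriangle G) (hI : IndepClasses G A B C) {x y z : V}
    (h₀ : CrossTriple G U A B C x y z) (hx : IsCentre G U A B x) :
    (∀ x' z', CrossTriple G U A B C x' y z' → x' = x ∧ z' = z) ∧ ¬ IsCentre G U B A y := by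
  obtain ⟨t, ht, hxt⟩ : ∃ t, B t ∧ MaxTriple G U x y t := by
    obtain ⟨hA, r, r', hr, hr', hm⟩ := hx
    have hyy : y = r ∨ y = r' := by
      by_contra! hne
      obtain ⟨k1, k2, k3, k4, k5, k6⟩ := hI
      rcases hm.2.2.2 y h₀.2.2.2.1.2.1 (fun h => k4 x hA (h ▸ h₀.2.1)) hne.1 hne.2 with e | e | e
      · exact h₀.2.2.2.2.2.1.1 e.symm
      · exact k2 _ _ h₀.2.1 hr e
      · exact k2 _ _ h₀.2.1 hr' e
    rcases hyy with rfl | rfl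
    · exact ⟨r', hr', hm⟩
    · exact ⟨r, hr, hm.swap.rotate⟩
  have hzt : z ≠ t := by rintro rfl; exact hI.disj₂₃ z ht h₀.2.2.1
  have ezt := h₀.2.2.2.adj hxt hzt
  refine ⟨?_, ?_⟩
  · intro x' z' h'
    by_contra hne
    have e := (h₀.rotate.adj hI.rotate h'.rotate (by tauto)).2.symm
    by_cases hxx : x' = x
    · subst hxx
      exact h₀.2.2.2.2.2.1.2.1 e
    obtain ⟨k1, k2, k3, k4, k5, k6⟩ := hI
    rcases hxt.2.2.2 x' h'.2.2.2.1.1 hxx (fun e => k4 x' h'.1 (e ▸ h'.2.1))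
      (fun e => k4 x' h'.1 (e ▸ ht)) with t' | t' | t'
    · exact k1 _ _ h'.1 h₀.1 t'
    · exact h'.2.2.2.2.2.1.1 t'
    · exact h x' z t e.symm.symm t' ezt
  · rintro ⟨hB, r, r', hr, hr', hm⟩
    obtain ⟨k1, k2, k3, k4, k5, k6⟩ := hI
    have hxx : x = r ∨ x = r' := by
      by_contra! hne
      rcases hm.2.2.2 x h₀.2.2.2.1.1 (fun e => k4 x h₀.1 (e ▸ hB)) hne.1 hne.2 with e | e | e
      · exact h₀.2.2.2.2.2.1.1 e
      · exact k1 _ _ h₀.1 hr e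
      · exact k1 _ _ h₀.1 hr' e
    obtain ⟨t', ht', hxt'⟩ : ∃ t', A t' ∧ MaxTriple G U x y t' := by
      rcases hxx with rfl | rfl
      · exact ⟨r', hr', hm.swap⟩
      · exact ⟨r, hr, hm.swap.rotate.swap⟩
    exact MaxTriple.false_of_three h h₀.2.2.2 hxt hxt' hzt
      (fun e => k5 t' ht' (e ▸ h₀.2.2.1)) (fun e => k4 t' ht' (e ▸ ht))

/-- Each crossing triple has a vertex which is not a centre and lies in no other crossing triple. -/
theorem CrossTriple.exists_private (h : NoTriangle G) (hI : IndepClasses G A B C) {x y z : V}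
    (h₀ : CrossTriple G U A B C x y z) :
    ∃ v, (v = x ∨ v = y ∨ v = z) ∧ ¬ IsCentre G U A B v ∧ ¬ IsCentre G U B A v ∧
      ∀ x' y' z', CrossTriple G U A B C x' y' z' → (v = x' ∨ v = y' ∨ v = z') →
        x' = x ∧ y' = y ∧ z' = z := by
  obtain ⟨k1, k2, k3, k4, k5, k6⟩ := id hI
  by_cases hx : IsCentre G U A B x
  · obtain ⟨h1, h2⟩ := h₀.eq_of_isCentre h hI hx
    refine ⟨y, by simp, fun h' => k4 y h'.1 h₀.2.1, h2, ?_⟩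
    intro x' y' z' h' hv
    rcases hv with rfl | rfl | rfl
    · exact absurd h₀.2.1 (k4 _ h'.1)
    · exact ⟨(h1 x' z' h').1, rfl, (h1 x' z' h').2⟩
    · exact absurd h'.2.2.1 (k6 _ h₀.2.1)
  by_cases hy : IsCentre G U B A y
  · obtain ⟨h1, h2⟩ := h₀.swap.eq_of_isCentre h hI.swap hy
    refine ⟨x, by simp, h2, fun h' => k4 x h₀.1 h'.1, ?_⟩
    intro x' y' z' h' hv
    rcases hv with rfl | rfl | rfl
    · exact ⟨rfl, h1 y' z' h'.swap⟩
    · exact absurd h'.2.1 (k4 _ h₀.1)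
    · exact absurd h'.2.2.1 (k5 _ h₀.1)
  have hx' : ¬ IsCentre G U B A x := fun h' => k4 x h₀.1 h'.1
  have hy' : ¬ IsCentre G U A B y := fun h' => k4 y h'.1 h₀.2.1
  have hz : ¬ IsCentre G U A B z := fun h' => k5 z h'.1 h₀.2.2.1
  have hz' : ¬ IsCentre G U B A z := fun h' => k6 z h'.1 h₀.2.2.1
  by_contra! hcon
  obtain ⟨x₁, y₁, z₁, h₁, e₁, n₁⟩ := hcon x (by simp) hx hx'
  obtain ⟨x₂, y₂, z₂, h₂, e₂, n₂⟩ := hcon z (by simp) hz hz'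
  obtain ⟨x₃, y₃, z₃, h₃, e₃, n₃⟩ := hcon y (by simp) hy' hy
  have f₁ : x = x₁ := by
    rcases e₁ with e | rfl | rfl
    · exact e
    · exact absurd h₁.2.1 (k4 _ h₀.1)
    · exact absurd h₁.2.2.1 (k5 _ h₀.1)
  have f₂ : z = z₂ := by
    rcases e₂ with rfl | rfl | e
    · exact absurd h₀.2.2.1 (k5 _ h₂.1)
    · exact absurd h₀.2.2.1 (k6 _ h₂.2.1)
    · exact e
  have f₃ : y = y₃ := by
    rcases e₃ with rfl | e | rfl
    · exact absurd h₀.2.1 (k4 _ h₃.1)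
    · exact e
    · exact absurd h₃.2.2.1 (k6 _ h₀.2.1)
  subst f₁ f₂ f₃
  refine h₀.false_of_shared h hI h₁ ?_ h₂ ?_ h₃ ?_
  · by_contra! e
    exact n₁ rfl e.1 e.2
  · by_contra! e
    exact n₂ e.1 e.2 rfl
  · by_contra! e
    exact n₃ e.1 rfl e.2

end Crossing

section TripleCount

open scoped Classical
open Finset

variable {V : Type*} {G : SimpleGraph V}

variable (G) in
/-- Three independent classes covering `U` apart from `a`, the first two extending the sides of a
bipartition of the non-neighbours of `a`. -/
structure TripleSplit (U : Finset V) (a : V) (X Y : Finset V) (A B C : V → Prop) : Prop where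
  mem : a ∈ U
  classes : IndepClasses G A B C
  left : ∀ v ∈ X, A v
  right : ∀ v ∈ Y, B v
  left_or : ∀ v, A v → v ∈ X ∨ G.Adj a v
  right_or : ∀ v, B v → v ∈ Y ∨ G.Adj a v
  rest : ∀ v, C v → G.Adj a v
  left_not : ∀ v ∈ X, v ≠ a ∧ ¬ G.Adj a v
  right_not : ∀ v ∈ Y, v ≠ a ∧ ¬ G.Adj a v
  pair : ∀ p q, MaxTriple G U a p q → p ∈ X ∧ q ∈ Y ∨ p ∈ Y ∧ q ∈ X

variable {U : Finset V} {a : V} {X Y : Finset V} {A B C : V → Prop}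

theorem TripleSplit.swap (s : TripleSplit G U a X Y A B C) : TripleSplit G U a Y X B A C :=
  ⟨s.mem, s.classes.swap, s.right, s.left, s.right_or, s.left_or, s.rest, s.right_not,
    s.left_not, fun p q h => (s.pair p q h).symm⟩

theorem TripleSplit.not_left (s : TripleSplit G U a X Y A B C) : ¬ A a := by
  intro h
  rcases s.left_or a h with h | h
  · exact (s.left_not a h).1 rfl
  · exact G.irrefl h

theorem TripleSplit.not_right (s : TripleSplit G U a X Y A B C) : ¬ B a := s.swap.not_left

theorem TripleSplit.not_rest (s : TripleSplit G U a X Y A B C) : ¬ C a :=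
  fun h => G.irrefl (s.rest a h)

theorem TripleSplit.adj_of_ne (s : TripleSplit G U a X Y A B C) {x y v : V} (hx : x ∈ X)
    (hy : y ∈ Y) (hxy : MaxTriple G U a x y) (hv : A v) (hvU : v ∈ U) (hvx : v ≠ x)
    (hvy : ¬ G.Adj v y) : G.Adj a v := by
  rcases s.left_or v hv with h | h
  · exfalso
    have hva := s.left_not v h
    rcases hxy.2.2.2 v hvU hva.1 hvx (fun e => s.classes.disj₁₂ v hv (e ▸ s.right y hy))
      with e | e | e
    · exact hva.2 e.symm
    · exact s.classes.indep₁ v x hv (s.left x hx) e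
    · exact hvy e
  · exact h

theorem TripleSplit.exists_third (s : TripleSplit G U a X Y A B C) {x y : V} (hy : y ∈ Y)
    (hxy : MaxTriple G U a x y) (hc : IsCentre G U A B x) :
    ∃ t, B t ∧ MaxTriple G U x y t := by
  obtain ⟨hA, r, r', hr, hr', hm⟩ := hc
  have hyy : y = r ∨ y = r' := by
    by_contra! hne
    have hB := s.right y hy
    rcases hm.2.2.2 y hxy.1.2.2 hxy.2.1.2.2.symm hne.1 hne.2 with e | e | e
    · exact hxy.2.2.1.2.2 e.symm
    · exact s.classes.indep₂ _ _ hB hr e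
    · exact s.classes.indep₂ _ _ hB hr' e
  rcases hyy with rfl | rfl
  · exact ⟨r', hr', hm⟩
  · exact ⟨r, hr, hm.swap.rotate⟩

theorem TripleSplit.not_centre_centre (h : NoTriangle G) (s : TripleSplit G U a X Y A B C)
    {x y : V} (hx : x ∈ X) (hy : y ∈ Y) (hxy : MaxTriple G U a x y) (hc : IsCentre G U A B x) :
    ¬ IsCentre G U B A y := by
  intro hc'
  obtain ⟨t, ht, hm⟩ := s.exists_third hy hxy hc
  obtain ⟨t', ht', hm'⟩ := s.swap.exists_third hx hxy.swap.rotate.swap.rotate.swap.rotate hc'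
  exact MaxTriple.false_of_three h hxy.rotate hm hm'.swap
    (fun e => s.not_right (e ▸ ht)) (fun e => s.not_left (e ▸ ht'))
    (fun e => s.classes.disj₁₂ t' ht' (e ▸ ht))

theorem TripleSplit.not_centre_cross (h : NoTriangle G) (s : TripleSplit G U a X Y A B C)
    {x y : V} (hx : x ∈ X) (hy : y ∈ Y) (hxy : MaxTriple G U a x y) (hc : IsCentre G U A B x)
    {p n : V} (hp : CrossTriple G U A B C p y n) : False := by
  obtain ⟨t, ht, hm⟩ := s.exists_third hy hxy hc
  by_cases hpx : p = x
  · subst hpx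
    exact MaxTriple.false_of_three h hxy.rotate hm hp.2.2.2
      (fun e => s.not_right (e ▸ ht)) (fun e => s.not_rest (e ▸ hp.2.2.1))
      (fun e => s.classes.disj₂₃ t ht (e ▸ hp.2.2.1))
  have hap := s.adj_of_ne hx hy hxy hp.1 hp.2.2.2.1.1 hpx hp.2.2.2.2.2.1.1
  have hpt : G.Adj p t := by
    rcases hm.2.2.2 p hp.2.2.2.1.1 hpx (fun e => s.classes.disj₁₂ p hp.1 (e ▸ hp.2.1))
      (fun e => s.classes.disj₁₂ p hp.1 (e ▸ ht)) with e | e | e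
    · exact absurd e (s.classes.indep₁ _ _ hp.1 (s.left x hx))
    · exact absurd e hp.2.2.2.2.2.1.1
    · exact e
  have hat := s.swap.adj_of_ne hy hx hxy.swap.rotate.swap.rotate.swap.rotate ht hm.1.2.2
    hm.2.1.2.2.symm (fun e => hm.2.2.1.2.1 e.symm)
  exact h a p t hap hat hpt

theorem TripleSplit.not_cross_cross (h : NoTriangle G) (s : TripleSplit G U a X Y A B C)
    {x y : V} (hx : x ∈ X) (hy : y ∈ Y) (hxy : MaxTriple G U a x y)
    {q n : V} (hq : CrossTriple G U A B C x q n) {p n' : V} (hp : CrossTriple G U A B C p y n')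
    (hpx : p ≠ x) (hqy : q ≠ y) : False := by
  have hap := s.adj_of_ne hx hy hxy hp.1 hp.2.2.2.1.1 hpx hp.2.2.2.2.2.1.1
  have haq := s.swap.adj_of_ne hy hx hxy.swap.rotate.swap.rotate.swap.rotate hq.2.1
    hq.2.2.2.1.2.1 hqy (fun e => hq.2.2.2.2.2.1.1 e.symm)
  have han := s.rest n hq.2.2.1
  rcases hq.2.2.2.2.2.2 p hp.2.2.2.1.1 hpx (fun e => s.classes.disj₁₂ p hp.1 (e ▸ hq.2.1))
    (fun e => s.classes.disj₁₃ p hp.1 (e ▸ hq.2.2.1)) with e | e | e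
  · exact s.classes.indep₁ _ _ hp.1 hq.1 e
  · exact h a p q hap haq e
  · exact h a p n hap han e

theorem IsCentre.eq (hI : IndepClasses G A B C) {c r₁ r₂ r₁' r₂' : V}
    (h₁ : B r₁) (h₂ : B r₂) (hm : MaxTriple G U c r₁ r₂) (h₁' : B r₁') (h₂' : B r₂')
    (hm' : MaxTriple G U c r₁' r₂') : ({c, r₁, r₂} : Finset V) = {c, r₁', r₂'} := by
  have aux : ∀ r₁ r₂ r₁' r₂' : V, B r₁ → B r₂ → MaxTriple G U c r₁ r₂ → B r₁' →
      MaxTriple G U c r₁' r₂' → r₁' = r₁ ∨ r₁' = r₂ := by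
    intro r₁ r₂ r₁' r₂' h₁ h₂ hm h₁' hm'
    by_contra! hne
    rcases hm.2.2.2 r₁' hm'.1.2.1 hm'.2.1.1.symm hne.1 hne.2 with e | e | e
    · exact hm'.2.2.1.1 e.symm
    · exact hI.indep₂ _ _ h₁' h₁ e
    · exact hI.indep₂ _ _ h₁' h₂ e
  have e1 := aux r₁ r₂ r₁' r₂' h₁ h₂ hm h₁' hm'
  have e2 := aux r₁ r₂ r₂' r₁' h₁ h₂ hm h₂' hm'.rotate.swap.rotate.rotate
  have e3 := hm.2.1.2.2
  have e4 := hm'.2.1.2.2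
  rcases e1 with rfl | rfl <;> rcases e2 with rfl | rfl
  · exact absurd rfl e4
  · rfl
  · rw [pair_comm]
  · exact absurd rfl e4

end TripleCount

section TripleCountMain

open scoped Classical
open Finset

variable {V : Type*} {G : SimpleGraph V} {U : Finset V} {a : V} {X Y : Finset V} {A B C : V → Prop}

variable (G) in
/-- `R` is a maximal independent triple meeting each of the three classes. -/
def IsCross (U : Finset V) (A B C : V → Prop) (R : Finset V) : Prop :=
  ∃ x y z, R = {x, y, z} ∧ CrossTriple G U A B C x y z

theorem IsCross.exists_private (h : NoTriangle G) (hI : IndepClasses G A B C) {R : Finset V}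
    (hR : IsCross G U A B C R) : ∃ v ∈ R, ¬ IsCentre G U A B v ∧ ¬ IsCentre G U B A v ∧
      ∀ R', IsCross G U A B C R' → v ∈ R' → R' = R := by
  obtain ⟨x, y, z, rfl, hx⟩ := hR
  obtain ⟨v, hv, h1, h2, h3⟩ := hx.exists_private h hI
  refine ⟨v, by simpa using hv, h1, h2, ?_⟩
  rintro _ ⟨x', y', z', rfl, hx'⟩ hv'
  obtain ⟨rfl, rfl, rfl⟩ := h3 x' y' z' hx' (by simpa using hv')
  rfl

theorem IsCross.left (hI : IndepClasses G A B C) {R : Finset V} (hR : IsCross G U A B C R) {x : V}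
    (hx : A x) (hxR : x ∈ R) : ∃ y z, R = {x, y, z} ∧ CrossTriple G U A B C x y z := by
  obtain ⟨x', y, z, rfl, h⟩ := hR
  simp only [mem_insert, mem_singleton] at hxR
  rcases hxR with rfl | rfl | rfl
  · exact ⟨y, z, rfl, h⟩
  · exact absurd h.2.1 (hI.disj₁₂ _ hx)
  · exact absurd h.2.2.1 (hI.disj₁₃ _ hx)

theorem IsCross.swap {R : Finset V} (hR : IsCross G U A B C R) : IsCross G U B A C R := by
  obtain ⟨x, y, z, rfl, h⟩ := hR
  exact ⟨y, x, z, by rw [insert_comm], h.swap⟩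

theorem TripleSplit.exists_free (h : NoTriangle G) (s : TripleSplit G U a X Y A B C)
    {g : Finset V → V} (hgm : ∀ R, IsCross G U A B C R → g R ∈ R)
    (hg : ∀ R, IsCross G U A B C R → ∀ R', IsCross G U A B C R' → g R ∈ R' → R' = R)
    {x y : V} (hx : x ∈ X) (hy : y ∈ Y) (hxy : MaxTriple G U a x y) :
    ∃ v, (v = x ∨ v = y) ∧ ¬ IsCentre G U A B v ∧ ¬ IsCentre G U B A v ∧
      ∀ R, IsCross G U A B C R → v ≠ g R := by
  have hA := s.left x hx
  have hB := s.right y hy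
  have hyx := hxy.swap.rotate.swap.rotate.swap.rotate
  have nx : ¬ IsCentre G U B A x := fun h' => s.classes.disj₁₂ x hA h'.1
  have ny : ¬ IsCentre G U A B y := fun h' => s.classes.disj₁₂ y h'.1 hB
  by_contra! hcon
  have cx := fun e => hcon x (by simp) e nx
  have cy := fun e => hcon y (by simp) ny e
  by_cases hcx : IsCentre G U A B x
  · obtain ⟨R, hR, hyR⟩ := cy (s.not_centre_centre h hx hy hxy hcx)
    obtain ⟨p, n, -, hp⟩ := hR.swap.left s.classes.swap hB (hyR ▸ hgm R hR)
    exact s.not_centre_cross h hx hy hxy hcx hp.swap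
  · by_cases hcy : IsCentre G U B A y
    · obtain ⟨R, hR, hxR⟩ := cx hcx
      obtain ⟨p, n, -, hp⟩ := hR.left s.classes hA (hxR ▸ hgm R hR)
      exact s.swap.not_centre_cross h hy hx hyx hcy hp.swap
    · obtain ⟨R, hR, hxR⟩ := cx hcx
      obtain ⟨R', hR', hyR⟩ := cy hcy
      have hne : R ≠ R' := by
        rintro rfl
        exact s.classes.disj₁₂ x hA (by rw [hxR, ← hyR]; exact hB)
      obtain ⟨q, n, hRe, hq⟩ := hR.left s.classes hA (hxR ▸ hgm R hR)
      obtain ⟨p, n', hRe', hp⟩ := hR'.swap.left s.classes.swap hB (hyR ▸ hgm R' hR')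
      refine s.not_cross_cross h hx hy hxy hq hp.swap ?_ ?_
      · rintro rfl
        exact hne (hg R hR R' hR' (by rw [← hxR, hRe']; simp)).symm
      · rintro rfl
        exact hne (hg R' hR' R hR (by rw [← hyR, hRe]; simp))

/-- The vertices charged to a maximal independent triple: a centre, the chosen private vertex of a
crossing triple, or an otherwise unused vertex of a triple through `a`. -/
inductive Charged (G : SimpleGraph V) (U : Finset V) (a : V) (A B C : V → Prop)
    (g : Finset V → V) : Finset V → V → Prop
  | left {c r r' : V} (hc : A c) (hr : B r) (hr' : B r') (hm : MaxTriple G U c r r') :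
      Charged G U a A B C g {c, r, r'} c
  | right {c r r' : V} (hc : B c) (hr : A r) (hr' : A r') (hm : MaxTriple G U c r r') :
      Charged G U a A B C g {c, r, r'} c
  | cross {R : Finset V} (hR : IsCross G U A B C R) : Charged G U a A B C g R (g R)
  | through {v w : V} (hm : MaxTriple G U a v w) (h1 : ¬ IsCentre G U A B v)
      (h2 : ¬ IsCentre G U B A v) (h3 : ∀ R, IsCross G U A B C R → v ≠ g R) :
      Charged G U a A B C g {a, v, w} v

theorem Charged.cases {g : Finset V → V} {R : Finset V} {v : V} (h : Charged G U a A B C g R v) :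
    (A v ∧ ∃ r r', B r ∧ B r' ∧ MaxTriple G U v r r' ∧ R = {v, r, r'}) ∨
    (B v ∧ ∃ r r', A r ∧ A r' ∧ MaxTriple G U v r r' ∧ R = {v, r, r'}) ∨
    (IsCross G U A B C R ∧ v = g R) ∨
    ∃ w, MaxTriple G U a v w ∧ ¬ IsCentre G U A B v ∧ ¬ IsCentre G U B A v ∧
      (∀ R, IsCross G U A B C R → v ≠ g R) ∧ R = {a, v, w} := by
  cases h with
  | left hc hr hr' hm => exact Or.inl ⟨hc, _, _, hr, hr', hm, rfl⟩
  | right hc hr hr' hm => exact Or.inr (Or.inl ⟨hc, _, _, hr, hr', hm, rfl⟩)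
  | cross hR => exact Or.inr (Or.inr (Or.inl ⟨hR, rfl⟩))
  | through hm h1 h2 h3 => exact Or.inr (Or.inr (Or.inr ⟨_, hm, h1, h2, h3, rfl⟩))

theorem TripleSplit.pair_unique (s : TripleSplit G U a X Y A B C) {v w w' : V}
    (hm : MaxTriple G U a v w) (hm' : MaxTriple G U a v w') : w = w' := by
  by_contra hne
  have e := hm.adj hm' hne
  rcases s.pair v w hm with h1 | h1 <;> rcases s.pair v w' hm' with h2 | h2
  · exact s.classes.indep₂ _ _ (s.right w h1.2) (s.right w' h2.2) e
  · exact s.classes.disj₁₂ v (s.left v h1.1) (s.right v h2.1)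
  · exact s.classes.disj₁₂ v (s.left v h2.1) (s.right v h1.1)
  · exact s.classes.indep₁ _ _ (s.left w h1.2) (s.left w' h2.2) e

theorem TripleSplit.card_le (h : NoTriangle G) (s : TripleSplit G U a X Y A B C)
    (hcl : ∀ R ∈ maxIndep G U 3, a ∉ R → ∃ x y r, R = {x, y, r} ∧ MaxTriple G U x y r ∧ A x ∧
      B y ∧ (A r ∨ B r ∨ C r)) : #(maxIndep G U 3) ≤ #U := by
  have hex : ∀ R, ∃ v, IsCross G U A B C R → v ∈ R ∧ ¬ IsCentre G U A B v ∧
      ¬ IsCentre G U B A v ∧ ∀ R', IsCross G U A B C R' → v ∈ R' → R' = R := by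
    intro R
    by_cases hR : IsCross G U A B C R
    · obtain ⟨v, hv⟩ := hR.exists_private h s.classes
      exact ⟨v, fun _ => hv⟩
    · exact ⟨a, fun h' => absurd h' hR⟩
  choose g hg using hex
  refine card_le_card_of_forall_subsingleton (Charged G U a A B C g) ?_ ?_
  · intro R hR
    have hsub := (mem_maxIndep.1 hR).1
    suffices H : ∃ v ∈ R, Charged G U a A B C g R v by
      obtain ⟨v, hv, hc⟩ := H
      exact ⟨v, hsub hv, hc⟩
    by_cases haR : a ∈ R
    · have hpq : ∃ p q, R = {a, p, q} ∧ MaxTriple G U a p q := by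
        obtain ⟨p, q, r, rfl, hm⟩ := mem_maxIndep_three.1 hR
        simp only [mem_insert, mem_singleton] at haR
        rcases haR with rfl | rfl | rfl
        · exact ⟨q, r, rfl, hm⟩
        · exact ⟨p, r, insert_comm _ _ _, hm.swap⟩
        · exact ⟨p, q, by rw [insert_comm a p, pair_comm a q], hm.rotate.rotate⟩
      obtain ⟨p, q, rfl, hm⟩ := hpq
      have hm' := hm.swap.rotate.swap.rotate.swap.rotate
      have hv : ∃ v, (v = p ∨ v = q) ∧ ¬ IsCentre G U A B v ∧ ¬ IsCentre G U B A v ∧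
          ∀ R, IsCross G U A B C R → v ≠ g R := by
        rcases s.pair p q hm with ⟨h1, h2⟩ | ⟨h1, h2⟩
        · exact s.exists_free h (fun R hR => (hg R hR).1) (fun R hR => (hg R hR).2.2.2) h1 h2 hm
        · obtain ⟨v, hv, hv'⟩ := s.exists_free h (fun R hR => (hg R hR).1)
            (fun R hR => (hg R hR).2.2.2) h2 h1 hm'
          exact ⟨v, hv.symm, hv'⟩
      obtain ⟨v, rfl | rfl, h1, h2, h3⟩ := hv
      · exact ⟨v, by simp, Charged.through hm h1 h2 h3⟩
      · rw [pair_comm]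
        exact ⟨v, by simp, Charged.through hm' h1 h2 h3⟩
    · obtain ⟨x, y, r, rfl, hm, hx, hy, hr | hr | hr⟩ := hcl R hR haR
      · rw [insert_comm]
        exact ⟨y, by simp, Charged.right hy hx hr hm.swap⟩
      · exact ⟨x, by simp, Charged.left hx hy hr hm⟩
      · have hc : IsCross G U A B C {x, y, r} := ⟨x, y, r, rfl, hx, hy, hr, hm⟩
        exact ⟨_, (hg _ hc).1, Charged.cross hc⟩
  · intro v _ R hR R' hR'
    have hR := hR.2
    have hR' := hR'.2
    have hI := s.classes
    have hnc : ∀ R, IsCross G U A B C R → ¬ IsCentre G U A B (g R) ∧ ¬ IsCentre G U B A (g R) :=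
      fun R hR => ⟨(hg R hR).2.1, (hg R hR).2.2.1⟩
    rcases hR.cases with ⟨hc, r, r', hr, hr', hm, rfl⟩ | ⟨hc, r, r', hr, hr', hm, rfl⟩ | ⟨hc, rfl⟩ |
      ⟨w, hm, h1, h2, h3, rfl⟩ <;>
    rcases hR'.cases with ⟨hc', q, q', hq, hq', hm', rfl⟩ | ⟨hc', q, q', hq, hq', hm', rfl⟩ |
      ⟨hc', hv⟩ | ⟨w', hm', h1', h2', h3', rfl⟩
    · exact IsCentre.eq hI hr hr' hm hq hq' hm'
    · exact absurd hc' (hI.disj₁₂ _ hc)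
    · exact absurd ⟨hc, r, r', hr, hr', hm⟩ (hv ▸ (hnc _ hc').1)
    · exact absurd ⟨hc, r, r', hr, hr', hm⟩ h1'
    · exact absurd hc (hI.disj₁₂ _ hc')
    · exact IsCentre.eq hI.swap hr hr' hm hq hq' hm'
    · exact absurd ⟨hc, r, r', hr, hr', hm⟩ (hv ▸ (hnc _ hc').2)
    · exact absurd ⟨hc, r, r', hr, hr', hm⟩ h2'
    · exact absurd ⟨hc', q, q', hq, hq', hm'⟩ (hnc _ hc).1
    · exact absurd ⟨hc', q, q', hq, hq', hm'⟩ (hnc _ hc).2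
    · exact ((hg _ hc).2.2.2 _ hc' (hv ▸ (hg _ hc').1)).symm
    · exact absurd rfl (h3' _ hc)
    · exact absurd ⟨hc', q, q', hq, hq', hm'⟩ h1
    · exact absurd ⟨hc', q, q', hq, hq', hm'⟩ h2
    · exact absurd hv (h3 _ hc')
    · rw [s.pair_unique hm hm']

end TripleCountMain

section TripleBound

open scoped Classical
open Finset

variable {V : Type*} {G : SimpleGraph V}

theorem card_maxIndep_two_le_side {Q X Y : Finset V} (hY : ∀ u ∈ Y, ∀ v ∈ Y, ¬ G.Adj u v)
    (hpair : ∀ p q, MaxPair G Q p q → p ∈ X ∧ q ∈ Y ∨ p ∈ Y ∧ q ∈ X) :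
    #(maxIndep G Q 2) ≤ #(X.filter fun x => ∃ y ∈ Y, MaxPair G Q x y) := by
  refine card_le_card_of_forall_subsingleton (fun R v => ∃ w ∈ Y, R = {v, w} ∧ MaxPair G Q v w)
    ?_ ?_
  · intro R hR
    obtain ⟨p, q, rfl, hpq⟩ := mem_maxIndep_two.1 hR
    rcases hpair p q hpq with ⟨h1, h2⟩ | ⟨h1, h2⟩
    · exact ⟨p, mem_filter.2 ⟨h1, q, h2, hpq⟩, q, h2, rfl, hpq⟩
    · exact ⟨q, mem_filter.2 ⟨h2, p, h1, hpq.symm⟩, p, h1, pair_comm _ _, hpq.symm⟩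
  · rintro v - R ⟨-, w, hw, rfl, hm⟩ R' ⟨-, w', hw', rfl, hm'⟩
    by_contra hne
    exact hY w hw w' hw' (hm.adj hm' fun e => hne (by rw [e]))

/-- A vertex dominates at most one of the paired vertices on one side. -/
theorem eq_of_dominates (h : NoTriangle G) {Q X Y : Finset V} (hQ : Q = X ∪ Y)
    (hX : ∀ u ∈ X, ∀ v ∈ X, ¬ G.Adj u v) (hY : ∀ u ∈ Y, ∀ v ∈ Y, ¬ G.Adj u v)
    (hd : Disjoint X Y) {v : V} (hv : (∃ x ∈ X, G.Adj x v) → ∃ y ∈ Y, G.Adj y v)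
    {p p' : V} (hp : p ∈ X) (hp' : p' ∈ X) (hpy : ∃ y ∈ Y, MaxPair G Q p y)
    (hpy' : ∃ y ∈ Y, MaxPair G Q p' y) (h1 : p = v ∨ G.Adj p v) (h2 : p' = v ∨ G.Adj p' v) :
    p = p' := by
  by_contra hne
  have h3 : G.Adj p v ∧ G.Adj p' v := by
    rcases h1 with rfl | h1 <;> rcases h2 with rfl | h2
    · exact absurd rfl hne
    · exact absurd h2 (hX _ hp' _ hp)
    · exact absurd h1 (hX _ hp _ hp')
    · exact ⟨h1, h2⟩
  obtain ⟨y, hy, hyv⟩ := hv ⟨p, hp, h3.1⟩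
  obtain ⟨y₁, hy₁, hm₁⟩ := hpy
  obtain ⟨y₂, hy₂, hm₂⟩ := hpy'
  have hyQ : y ∈ Q := hQ ▸ mem_union_right _ hy
  have key : ∀ {q z}, q ∈ X → z ∈ Y → MaxPair G Q q z → G.Adj q v → y = z := by
    intro q z hq hz hm hqv
    by_contra hyz
    rcases hm.2.2.2.2 y hyQ (fun e => Finset.disjoint_left.1 hd hq (e ▸ hy)) hyz with e | e
    · exact h y q v e hyv hqv
    · exact hY y hy z hz e
  obtain rfl := key hp hy₁ hm₁ h3.1
  obtain rfl := key hp' hy₂ hm₂ h3.2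
  exact hX _ hp _ hp' (hm₁.symm.adj hm₂.symm hne)

theorem exists_side_of_triple (h : NoTriangle G) {U Q X Y : Finset V} (hQU : Q ⊆ U)
    (hQ : Q = X ∪ Y)
    (hX : ∀ u ∈ X, ∀ v ∈ X, ¬ G.Adj u v) (hY : ∀ u ∈ Y, ∀ v ∈ Y, ¬ G.Adj u v)
    (hpair : ∀ p q, MaxPair G Q p q → p ∈ X ∧ q ∈ Y ∨ p ∈ Y ∧ q ∈ X) (hd : Disjoint X Y)
    (h4 : 4 ≤ #(maxIndep G Q 2)) {p q r : V} (hm : MaxTriple G U p q r) :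
    ∃ v, (v = p ∨ v = q ∨ v = r) ∧ (∃ x ∈ X, G.Adj x v) ∧ ∀ y ∈ Y, ¬ G.Adj y v := by
  by_contra! hcon
  have hcon' : ∀ v, (v = p ∨ v = q ∨ v = r) → (∃ x ∈ X, G.Adj x v) → ∃ y ∈ Y, G.Adj y v := by
    exact fun v hv hx => hcon v hv hx
  have hcard := card_maxIndep_two_le_side hY hpair
  have hle : #(X.filter fun x => ∃ y ∈ Y, MaxPair G Q x y) ≤ #({p, q, r} : Finset V) := by
    refine card_le_card_of_forall_subsingleton (fun x v => x = v ∨ G.Adj x v) ?_ ?_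
    · intro x hx
      have hxU : x ∈ U := hQU (hQ ▸ mem_union_left _ (mem_filter.1 hx).1)
      by_contra! hne
      have hp := hne p (by simp)
      have hq := hne q (by simp)
      have hr := hne r (by simp)
      rcases hm.2.2.2 x hxU hp.1 hq.1 hr.1 with e | e | e
      · exact hp.2 e
      · exact hq.2 e
      · exact hr.2 e
    · rintro v hv x ⟨hx, hxv⟩ x' ⟨hx', hxv'⟩
      obtain ⟨a1, a2⟩ := mem_filter.1 hx
      obtain ⟨b1, b2⟩ := mem_filter.1 hx'
      exact eq_of_dominates h hQ hX hY hd (hcon' v (by simpa using hv)) a1 b1 a2 b2 hxv hxv'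
  have := card_le_three (a := p) (b := q) (c := r)
  lia

theorem card_maxIndep_three_le (h : NoTriangle G) (U : Finset V) :
    #(maxIndep G U 3) ≤ #U + 128 := by
  by_cases h3 : ∀ a ∈ U, maxIndepAt G U 3 a ≤ 3
  · have h1 := sum_maxIndepAt (G := G) U 3
    have h2 := sum_le_sum h3
    rw [sum_const, smul_eq_mul] at h2
    lia
  push Not at h3
  obtain ⟨a, ha, h3⟩ := h3
  have h4 : 4 ≤ #(maxIndep G (nonNbrs G U a) 2) := le_trans h3 (maxIndepAt_le U 2 a)
  by_cases h7 : 7 ≤ #(nonNbrs G U a)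
  · obtain ⟨X, Y, hQ, hd, hX, hY, hpair⟩ := exists_bipartition h h4 h7
    refine le_trans ?_ (Nat.le_add_right _ _)
    have hXU : ∀ v ∈ X, v ∈ U ∧ v ≠ a ∧ ¬ G.Adj a v :=
      fun v hv => mem_nonNbrs.1 (hQ ▸ mem_union_left _ hv)
    have hYU : ∀ v ∈ Y, v ∈ U ∧ v ≠ a ∧ ¬ G.Adj a v :=
      fun v hv => mem_nonNbrs.1 (hQ ▸ mem_union_right _ hv)
    have hcov : ∀ v ∈ U, v = a ∨ v ∈ X ∨ v ∈ Y ∨ G.Adj a v := by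
      intro v hv
      by_contra! hne
      have := mem_nonNbrs.2 ⟨hv, hne.1, hne.2.2.2⟩
      rw [hQ, mem_union] at this
      tauto
    have hdd : ∀ v, v ∈ X → v ∉ Y := fun v hv => Finset.disjoint_left.1 hd hv
    have s : TripleSplit G U a X Y
        (fun v => v ∈ X ∨ G.Adj a v ∧ (∃ y ∈ Y, G.Adj y v) ∧ ∀ x ∈ X, ¬ G.Adj x v)
        (fun v => v ∈ Y ∨ G.Adj a v ∧ ∀ y ∈ Y, ¬ G.Adj y v)
        (fun v => G.Adj a v ∧ (∃ y ∈ Y, G.Adj y v) ∧ ∃ x ∈ X, G.Adj x v) := by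
      refine ⟨ha, ⟨?_, ?_, ?_, ?_, ?_, ?_⟩, fun v hv => Or.inl hv, fun v hv => Or.inl hv,
        fun v hv => hv.imp_right And.left, fun v hv => hv.imp_right And.left, fun v hv => hv.1,
        fun v hv => (hXU v hv).2, fun v hv => (hYU v hv).2, ?_⟩
      · rintro u v (hu | ⟨hu, hu1, hu2⟩) (hv | ⟨hv, hv1, hv2⟩) huv
        · exact hX u hu v hv huv
        · exact hv2 u hu huv
        · exact hu2 v hv huv.symm
        · exact h a u v hu hv huv
      · rintro u v (hu | ⟨hu, hu1⟩) (hv | ⟨hv, hv1⟩) huv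
        · exact hY u hu v hv huv
        · exact hv1 u hu huv
        · exact hu1 v hv huv.symm
        · exact h a u v hu hv huv
      · intro u v hu hv huv
        exact h a u v hu.1 hv.1 huv
      · rintro v (hv | ⟨hv, ⟨y, hy, hyv⟩, -⟩) (hv' | ⟨hv', hv2⟩)
        · exact hdd v hv hv'
        · exact (hXU v hv).2.2 hv'
        · exact (hYU v hv').2.2 hv
        · exact hv2 y hy hyv
      · rintro v (hv | ⟨hv, -, hv2⟩) ⟨hv', -, x, hx, hxv⟩
        · exact (hXU v hv).2.2 hv'
        · exact hv2 x hx hxv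
      · rintro v (hv | ⟨hv, hv2⟩) ⟨hv', ⟨y, hy, hyv⟩, -⟩
        · exact (hYU v hv).2.2 hv'
        · exact hv2 y hy hyv
      · intro p q hm
        refine hpair p q ⟨mem_nonNbrs.2 ⟨hm.1.2.1, hm.2.1.1.symm, hm.2.2.1.1⟩,
          mem_nonNbrs.2 ⟨hm.1.2.2, hm.2.1.2.1.symm, hm.2.2.1.2.1⟩, hm.2.1.2.2, hm.2.2.1.2.2, ?_⟩
        intro v hv hvp hvq
        obtain ⟨b1, b2, b3⟩ := mem_nonNbrs.1 hv
        exact (hm.2.2.2 v b1 b2 hvp hvq).resolve_left fun e => b3 e.symm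
    refine s.card_le h ?_
    intro R hR haR
    obtain ⟨p, q, r, rfl, hm⟩ := mem_maxIndep_three.1 hR
    simp only [mem_insert, mem_singleton, not_or] at haR
    have hQU := nonNbrs_subset (G := G) U a
    obtain ⟨v, hv, hv1, hv2⟩ := exists_side_of_triple h hQU hQ hX hY hpair hd h4 hm
    obtain ⟨w, hw, hw1, hw2⟩ := exists_side_of_triple h hQU (by rw [hQ, union_comm]) hY hX
      (fun p q hpq => (hpair p q hpq).symm) hd.symm h4 hm
    have hcl : ∀ u ∈ U, u ≠ a →
        (u ∈ X ∨ G.Adj a u ∧ (∃ y ∈ Y, G.Adj y u) ∧ ∀ x ∈ X, ¬ G.Adj x u) ∨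
        (u ∈ Y ∨ G.Adj a u ∧ ∀ y ∈ Y, ¬ G.Adj y u) ∨
        (G.Adj a u ∧ (∃ y ∈ Y, G.Adj y u) ∧ ∃ x ∈ X, G.Adj x u) := by
      intro u hu hua
      rcases hcov u hu with h1 | h1 | h1 | h1
      · exact absurd h1 hua
      · exact Or.inl (Or.inl h1)
      · exact Or.inr (Or.inl (Or.inl h1))
      · by_cases hx : ∃ x ∈ X, G.Adj x u
        · by_cases hy : ∃ y ∈ Y, G.Adj y u
          · exact Or.inr (Or.inr ⟨h1, hy, hx⟩)
          · push Not at hy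
            exact Or.inr (Or.inl (Or.inr ⟨h1, hy⟩))
        · by_cases hy : ∃ y ∈ Y, G.Adj y u
          · push Not at hx
            exact Or.inl (Or.inr ⟨h1, hy, hx⟩)
          · push Not at hy
            exact Or.inr (Or.inl (Or.inr ⟨h1, hy⟩))
    have hpU := hcl p hm.1.1 (Ne.symm haR.1)
    have hqU := hcl q hm.1.2.1 (Ne.symm haR.2.1)
    have hrU := hcl r hm.1.2.2 (Ne.symm haR.2.2)
    have hvU : v ∈ U ∧ v ≠ a := by
      rcases hv with rfl | rfl | rfl
      · exact ⟨hm.1.1, Ne.symm haR.1⟩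
      · exact ⟨hm.1.2.1, Ne.symm haR.2.1⟩
      · exact ⟨hm.1.2.2, Ne.symm haR.2.2⟩
    have hwU : w ∈ U ∧ w ≠ a := by
      rcases hw with rfl | rfl | rfl
      · exact ⟨hm.1.1, Ne.symm haR.1⟩
      · exact ⟨hm.1.2.1, Ne.symm haR.2.1⟩
      · exact ⟨hm.1.2.2, Ne.symm haR.2.2⟩
    have hvB : v ∈ Y ∨ G.Adj a v ∧ ∀ y ∈ Y, ¬ G.Adj y v := by
      obtain ⟨x, hx, hxv⟩ := hv1
      rcases hcov v hvU.1 with h1 | h1 | h1 | h1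
      · exact absurd h1 hvU.2
      · exact absurd hxv (hX x hx v h1)
      · exact Or.inl h1
      · exact Or.inr ⟨h1, hv2⟩
    have hwA : w ∈ X ∨ G.Adj a w ∧ (∃ y ∈ Y, G.Adj y w) ∧ ∀ x ∈ X, ¬ G.Adj x w := by
      rcases hcov w hwU.1 with h1 | h1 | h1 | h1
      · exact absurd h1 hwU.2
      · exact Or.inl h1
      · obtain ⟨y, hy, hyw⟩ := hw1
        exact absurd hyw (hY y hy w h1)
      · exact Or.inr ⟨h1, hw1, hw2⟩
    have hwv : w ≠ v := by
      rintro rfl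
      obtain ⟨x, hx, hxw⟩ := hv1
      exact hw2 x hx hxw
    rcases hw with rfl | rfl | rfl <;> rcases hv with rfl | rfl | rfl
    · exact absurd rfl hwv
    · exact ⟨w, v, r, rfl, hm, hwA, hvB, hrU⟩
    · exact ⟨w, v, q, by rw [pair_comm], hm.rotate.swap.rotate.rotate, hwA, hvB, hqU⟩
    · exact ⟨w, v, r, insert_comm _ _ _, hm.swap, hwA, hvB, hrU⟩
    · exact absurd rfl hwv
    · exact ⟨w, v, p, by rw [insert_comm, pair_comm p v], hm.rotate, hwA, hvB, hpU⟩
    · exact ⟨w, v, q, by rw [pair_comm q w, insert_comm], hm.rotate.rotate, hwA, hvB, hqU⟩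
    · exact ⟨w, v, p, by rw [insert_comm, pair_comm p w, insert_comm],
        hm.rotate.swap, hwA, hvB, hpU⟩
    · exact absurd rfl hwv
  · refine (card_maxIndep_le_two_pow h U 3 a).trans ?_
    have : 2 ^ (#(nonNbrs G U a) + 1) ≤ 2 ^ 7 := Nat.pow_le_pow_right (by norm_num) (by lia)
    lia

end TripleBound

section Asymptotics

open scoped Classical
open Finset

theorem exists_card_maxIndep_two_le {η : ℝ} (hη : 0 < η) : ∃ C : ℝ, 0 ≤ C ∧
    ∀ (V : Type) (G : SimpleGraph V), NoTriangle G → ∀ U : Finset V,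
      (#(maxIndep G U 2) : ℝ) ≤ η * degSum G U + C := by
  refine ⟨2 + 2 / η, by positivity, fun V G h U => ?_⟩
  have h1 : (#(maxIndep G U 2) : ℝ) ≤ #U := by exact_mod_cast card_maxIndep_two_le h U
  have h2 : (#(maxIndep G U 2) : ℝ) * #U ≤ #(maxIndep G U 2) * 2 + 2 * degSum G U := by
    exact_mod_cast card_maxIndep_two_mul_le h U
  have hE : (0 : ℝ) ≤ degSum G U := by positivity
  rcases le_total (#U : ℝ) (2 + 2 / η) with h3 | h3
  · nlinarith
  · have h4 : (2 : ℝ) ≤ η * (#U - 2) := by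
      have := mul_le_mul_of_nonneg_left h3 hη.le
      rw [mul_add, mul_div_cancel₀ _ hη.ne'] at this
      linarith
    have h5 : (0 : ℝ) ≤ 2 / η := by positivity
    have h6 : (#(maxIndep G U 2) : ℝ) * 2 ≤ η * degSum G U * 2 := by
      calc (#(maxIndep G U 2) : ℝ) * 2 ≤ #(maxIndep G U 2) * (η * (#U - 2)) := by gcongr
        _ = η * (#(maxIndep G U 2) * #U - #(maxIndep G U 2) * 2) := by ring
        _ ≤ η * (2 * degSum G U) := by gcongr; linarith
        _ = _ := by ring
    linarith

theorem exists_card_maxIndep_three_le {η : ℝ} (hη : 0 < η) : ∃ C : ℝ, 0 ≤ C ∧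
    ∀ (V : Type) (G : SimpleGraph V), NoTriangle G → ∀ U : Finset V,
      (#(maxIndep G U 3) : ℝ) ≤ η * degSum G U + C := by
  obtain ⟨C', hC', H⟩ := exists_card_maxIndep_two_le (η := η * (η / 4)) (by positivity)
  set M : ℝ := 47 + 2 * C' / η with hM
  have hM0 : 0 ≤ 2 * C' / η := by positivity
  refine ⟨M + 128, by positivity, fun V G h U => ?_⟩
  have h1 : (#(maxIndep G U 3) : ℝ) ≤ #U + 128 := by exact_mod_cast card_maxIndep_three_le h U
  have hE : (0 : ℝ) ≤ degSum G U := by positivity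
  have hηE := mul_nonneg hη.le hE
  rcases le_total (#U : ℝ) M with h3 | h3
  · linarith
  by_cases h4 : (#U : ℝ) + 128 ≤ η * degSum G U
  · linarith
  push Not at h4
  have h5 : ∀ a ∈ U, (maxIndepAt G U 3 a : ℝ) ≤ η / 4 * (#U + 128) + C' := by
    intro a _
    calc (maxIndepAt G U 3 a : ℝ) ≤ #(maxIndep G (nonNbrs G U a) 2) := by
          exact_mod_cast maxIndepAt_le U 2 a
      _ ≤ η * (η / 4) * degSum G (nonNbrs G U a) + C' := H V G h _
      _ ≤ η * (η / 4) * degSum G U + C' := by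
          gcongr
          exact degSum_mono (nonNbrs_subset U a)
      _ = η / 4 * (η * degSum G U) + C' := by ring
      _ ≤ _ := by gcongr
  have h6 : (#(maxIndep G U 3) : ℝ) * #U ≤ #(maxIndep G U 3) * 3 +
      ∑ a ∈ U, (maxIndepAt G U 3 a : ℝ) * degIn G U a := by
    exact_mod_cast mul_card_le_sum_mul_degIn U 3
  have h7 : ∑ a ∈ U, (maxIndepAt G U 3 a : ℝ) * degIn G U a ≤
      (η / 4 * (#U + 128) + C') * degSum G U := by
    rw [degSum, Nat.cast_sum, mul_sum]
    exact sum_le_sum fun a ha => mul_le_mul_of_nonneg_right (h5 a ha) (by positivity)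
  have h8 : η / 4 * (#U + 128) + C' ≤ η * (#U - 3) := by
    have h9 : η * (2 * C' / η) = 2 * C' := by field_simp
    have h10 := mul_le_mul_of_nonneg_left h3 hη.le
    rw [hM, mul_add, h9] at h10
    nlinarith
  have h9 : (#(maxIndep G U 3) : ℝ) * (#U - 3) ≤ η * degSum G U * (#U - 3) := by
    have := mul_le_mul_of_nonneg_right h8 hE
    linarith
  have h10 : (0 : ℝ) < #U - 3 := by linarith
  have := le_of_mul_le_mul_right h9 h10
  linarith

theorem degree_load_nonneg {d r m η : ℝ} (hd : 0 ≤ d) (hr : 0 ≤ r) (hη : 0 < η) (hη1 : η ≤ 1)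
    (hm : 1905 ≤ η * m) (hdm : d ≤ m) (h : d + r ≤ m + 127) :
    0 ≤ d - r / 3 - 16 / 9 * (r * d / m - r / 4) + η * r := by
  have hm0 : 0 < m := by nlinarith
  have key : 0 ≤ d * (9 * m) - r * (16 * d - m) + 9 * η * r * m := by
    by_cases h1 : 16 * d ≤ m
    · have : 0 ≤ r * (m - 16 * d) := mul_nonneg hr (by linarith)
      have : 0 ≤ 9 * η * r * m := by positivity
      have : 0 ≤ d * (9 * m) := by positivity
      linarith
    · push Not at h1
      by_cases h2 : 16 * d - m ≤ 9 * η * m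
      · have : 0 ≤ r * (9 * η * m - (16 * d - m)) := mul_nonneg hr (by linarith)
        have : 0 ≤ d * (9 * m) := by positivity
        linarith
      push Not at h2
      have h3 : r * (16 * d - m - 9 * η * m) ≤ (m + 127 - d) * (16 * d - m - 9 * η * m) :=
        mul_le_mul_of_nonneg_right (by linarith) (by linarith)
      suffices 0 ≤ d * (9 * m) - (m + 127 - d) * (16 * d - m - 9 * η * m) by linarith
      have h4 : d * (9 * m) - (m + 127 - d) * (16 * d - m - 9 * η * m) =
        (4 * d - m) ^ 2 - 127 * (16 * d - m) + 9 * η * m * (m + 127 - d) := by ring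
      rw [h4]
      have hm1 : 1905 ≤ m := by nlinarith
      by_cases h5 : 2 * d ≤ m
      · have : 1905 * (m / 2) ≤ η * m * (m + 127 - d) := by
          apply mul_le_mul hm (by linarith) (by linarith) (by positivity)
        nlinarith [sq_nonneg (4 * d - m)]
      · push Not at h5
        have h6 : m ^ 2 ≤ (4 * d - m) ^ 2 := by
          apply pow_le_pow_left₀ hm0.le; linarith
        have : 0 ≤ 9 * η * m * (m + 127 - d) := by
          apply mul_nonneg (by positivity); linarith
        nlinarith
  have e : d - r / 3 - 16 / 9 * (r * d / m - r / 4) + η * r =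
      (d * (9 * m) - r * (16 * d - m) + 9 * η * r * m) / (9 * m) := by
    field_simp
    ring
  rw [e]
  positivity

theorem exists_card_maxIndep_four_le {η : ℝ} (hη : 0 < η) : ∃ C : ℝ, 0 ≤ C ∧
    ∀ (V : Type) (G : SimpleGraph V), NoTriangle G → ∀ U : Finset V,
      (4 / 3 - η) * (#(maxIndep G U 4) : ℝ) ≤ degSum G U + C := by
  set θ : ℝ := min (η / 8) 1 with hθ
  have hθ0 : 0 < θ := by positivity
  have hθ1 : θ ≤ 1 := min_le_right _ _
  have hθη : θ ≤ η / 8 := min_le_left _ _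
  set M : ℝ := 1905 / θ with hM
  refine ⟨4 / 3 * 2 ^ ⌈M⌉₊, by positivity, fun V G h U => ?_⟩
  have hE : (0 : ℝ) ≤ degSum G U := by positivity
  have hμ : (0 : ℝ) ≤ #(maxIndep G U 4) := by positivity
  rcases lt_or_ge (#U : ℝ) M with h3 | h3
  · have h4 : #(maxIndep G U 4) ≤ 2 ^ #U := by
      rw [← card_powerset]
      exact card_le_card fun R hR => mem_powerset.2 (mem_maxIndep.1 hR).1
    have h5 : 2 ^ #U ≤ 2 ^ ⌈M⌉₊ := Nat.pow_le_pow_right (by norm_num)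
      (by exact_mod_cast (h3.le.trans (Nat.le_ceil M)))
    have h6 : (#(maxIndep G U 4) : ℝ) ≤ 2 ^ ⌈M⌉₊ := by exact_mod_cast h4.trans h5
    nlinarith
  have hm : 1905 ≤ θ * #U := by
    have := mul_le_mul_of_nonneg_left h3 hθ0.le
    rwa [hM, mul_div_cancel₀ _ hθ0.ne'] at this
  have hm0 : (0 : ℝ) < #U := by nlinarith
  have h1 : ∀ a ∈ U, (0 : ℝ) ≤ degIn G U a - (maxIndepAt G U 4 a : ℝ) / 3 -
      16 / 9 * ((maxIndepAt G U 4 a : ℝ) * degIn G U a / #U - (maxIndepAt G U 4 a : ℝ) / 4) +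
      θ * maxIndepAt G U 4 a := by
    intro a ha
    have h5 := card_nonNbrs (G := G) ha
    have h6 := (maxIndepAt_le (G := G) U 3 a).trans (card_maxIndep_three_le h _)
    refine degree_load_nonneg (by positivity) (by positivity) hθ0 hθ1 hm ?_ ?_
    · exact_mod_cast (by lia : degIn G U a ≤ #U)
    · exact_mod_cast (by lia : degIn G U a + maxIndepAt G U 4 a ≤ #U + 127)
  have h2 := sum_nonneg h1
  have h4 : ∑ a ∈ U, (maxIndepAt G U 4 a : ℝ) = 4 * #(maxIndep G U 4) := by
    exact_mod_cast sum_maxIndepAt (G := G) U 4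
  have h5 : (#(maxIndep G U 4) : ℝ) * #U ≤ #(maxIndep G U 4) * 4 +
      ∑ a ∈ U, (maxIndepAt G U 4 a : ℝ) * degIn G U a := by
    exact_mod_cast mul_card_le_sum_mul_degIn U 4
  have h6 : ∑ a ∈ U, (degIn G U a : ℝ) = degSum G U := by
    rw [degSum]; push_cast; rfl
  have h7 : #(maxIndep G U 4) - 4 * #(maxIndep G U 4) / #U ≤
      (∑ a ∈ U, (maxIndepAt G U 4 a : ℝ) * degIn G U a) / #U := by
    rw [le_div_iff₀ hm0, sub_mul, div_mul_cancel₀ _ hm0.ne']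
    linarith
  have h8 : 4 * (#(maxIndep G U 4) : ℝ) / #U ≤ θ * #(maxIndep G U 4) := by
    rw [div_le_iff₀ hm0]
    nlinarith
  simp only [sum_add_distrib, sum_sub_distrib, ← mul_sum, ← sum_div, h4, h6] at h2
  have h9 : θ * #(maxIndep G U 4) ≤ η / 8 * #(maxIndep G U 4) := by gcongr
  have h10 : (0 : ℝ) ≤ 4 / 3 * 2 ^ ⌈M⌉₊ := by positivity
  nlinarith

end Asymptotics

section LowDegree

open scoped Classical
open Finset

theorem sum_degIn_comm {V : Type} {G : SimpleGraph V} (S T : Finset V) :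
    ∑ v ∈ S, degIn G T v = ∑ v ∈ T, degIn G S v := by
  simp only [degIn, card_filter]
  rw [sum_comm]
  simp only [G.adj_comm]

variable {V : Type} [Fintype V] {G : SimpleGraph V}

theorem degSum_univ (G : SimpleGraph V) : degSum G univ = 2 * G.edgeSet.ncard := by
  have h := G.sum_degrees_eq_twice_card_edges
  rw [← Set.ncard_coe_finset, coe_edgeFinset] at h
  rw [← h, degSum]
  refine sum_congr rfl fun v _ => ?_
  rw [degIn, ← card_neighborFinset_eq_degree]
  congr 1
  ext w
  simp

theorem degIn_eq_ncard (v : V) : degIn G univ v = (G.neighborSet v).ncard := by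
  rw [degIn, ← Set.ncard_coe_finset]
  congr 1
  ext w
  simp

theorem degIn_add_compl (S : Finset V) (v : V) :
    degIn G univ v = degIn G S v + degIn G Sᶜ v := by
  rw [degIn, degIn, degIn, ← card_union_of_disjoint, ← filter_union, union_compl]
  exact disjoint_filter_filter disjoint_compl_right

/-- Edges counted from the vertices outside `H`, together with the edges inside `H`. -/
theorem sum_degIn_compl_le (G : SimpleGraph V) (H : Finset V) :
    2 * ∑ v ∈ Hᶜ, degIn G H v + degSum G H ≤ 2 * G.edgeSet.ncard := by
  have h : degSum G univ = ∑ v ∈ H, degIn G univ v + ∑ v ∈ Hᶜ, degIn G univ v := by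
    rw [degSum, ← sum_add_sum_compl H]
  simp only [degIn_add_compl H, sum_add_distrib] at h
  rw [sum_degIn_comm H Hᶜ, degSum_univ] at h
  rw [degSum]
  lia

variable (G) in
/-- `H` contains all vertices of large degree of a triangle-free graph of diameter two whose twins
have a common neighbour outside `H`. -/
structure Admissible (D : ℕ) (H : Finset V) : Prop where
  noTriangle : NoTriangle G
  diam : ∀ u v, u ≠ v → ¬ G.Adj u v → ∃ w, G.Adj u w ∧ G.Adj w v
  twin : ∀ u v, u ≠ v → (∀ w, G.Adj u w ↔ G.Adj v w) → ∃ w, w ∉ H ∧ G.Adj w u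
  deg_le : ∀ v, v ∉ H → degIn G univ v ≤ D

variable (G) in
/-- The vertices outside `H` with at most five neighbours in `H` and adjacent to all of `K`. -/
noncomputable def lowDeg (H K : Finset V) : Finset V :=
  univ.filter fun v => v ∉ H ∧ (∀ k ∈ K, G.Adj v k) ∧ degIn G H v ≤ 5

variable (G) in
/-- The vertices of `H` outside `K` with no neighbour in `K`. -/
noncomputable def farFrom (H K : Finset V) : Finset V :=
  H.filter fun h => h ∉ K ∧ ∀ k ∈ K, ¬ G.Adj h k

theorem mem_lowDeg {H K : Finset V} {v : V} :
    v ∈ lowDeg G H K ↔ v ∉ H ∧ (∀ k ∈ K, G.Adj v k) ∧ degIn G H v ≤ 5 := by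
  simp [lowDeg]

theorem mem_farFrom {H K : Finset V} {v : V} :
    v ∈ farFrom G H K ↔ v ∈ H ∧ v ∉ K ∧ ∀ k ∈ K, ¬ G.Adj v k := by
  simp [farFrom]

theorem card_lowDeg_le_of_far {D : ℕ} {H K : Finset V} (hG : Admissible G D H) {w : V}
    (hw : w ∉ H) (hwK : ∀ k ∈ K, ¬ G.Adj w k) {b : ℝ} (hb0 : 0 ≤ b)
    (hb : ∀ a ∈ H, a ∉ K → (#(lowDeg G H (insert a K)) : ℝ) ≤ b) :
    (#(lowDeg G H K) : ℝ) ≤ 1 + D + D * D + D * b := by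
  have hsub : lowDeg G H K ⊆ {w} ∪ univ.filter (G.Adj w) ∪
      (Hᶜ.filter (G.Adj w)).biUnion (fun a => univ.filter (G.Adj a)) ∪
      (H.filter (G.Adj w)).biUnion (fun a => lowDeg G H (insert a K)) := by
    intro v hv
    obtain ⟨h1, h2, h3⟩ := mem_lowDeg.1 hv
    simp only [mem_union, mem_biUnion, mem_filter, mem_singleton, mem_univ, true_and, mem_compl]
    by_cases hvw : v = w
    · exact Or.inl (Or.inl (Or.inl hvw))
    by_cases hadj : G.Adj w v
    · exact Or.inl (Or.inl (Or.inr hadj))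
    obtain ⟨a, ha, hav⟩ := hG.diam w v (Ne.symm hvw) hadj
    by_cases haH : a ∈ H
    · refine Or.inr ⟨a, ⟨haH, ha⟩, mem_lowDeg.2 ⟨h1, ?_, h3⟩⟩
      intro k hk
      rcases mem_insert.1 hk with rfl | hk
      · exact hav.symm
      · exact h2 k hk
    · exact Or.inl (Or.inr ⟨a, ⟨haH, ha⟩, hav⟩)
  have hdw : degIn G univ w ≤ D := hG.deg_le w hw
  have c1 : #((Hᶜ.filter (G.Adj w)).biUnion (fun a => univ.filter (G.Adj a))) ≤ D * D := by
    refine (card_biUnion_le_card_mul _ _ D fun a ha => ?_).trans (Nat.mul_le_mul_right _ ?_)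
    · exact hG.deg_le a (mem_compl.1 (mem_filter.1 ha).1)
    · exact (degIn_mono (subset_univ _) w).trans hdw
  have c2 : (#((H.filter (G.Adj w)).biUnion (fun a => lowDeg G H (insert a K))) : ℝ) ≤ D * b := by
    calc (#((H.filter (G.Adj w)).biUnion (fun a => lowDeg G H (insert a K))) : ℝ)
        ≤ ∑ a ∈ H.filter (G.Adj w), (#(lowDeg G H (insert a K)) : ℝ) := by
          exact_mod_cast card_biUnion_le
      _ ≤ ∑ a ∈ H.filter (G.Adj w), b := by
          refine sum_le_sum fun a ha => ?_
          obtain ⟨h1, h2⟩ := mem_filter.1 ha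
          exact hb a h1 fun h => hwK a h h2
      _ = (degIn G H w : ℝ) * b := by rw [sum_const, nsmul_eq_mul, degIn]
      _ ≤ D * b := by
          gcongr
          exact (degIn_mono (subset_univ _) w).trans hdw
  have c3 : #({w} ∪ univ.filter (G.Adj w) ∪
      (Hᶜ.filter (G.Adj w)).biUnion (fun a => univ.filter (G.Adj a))) ≤ 1 + D + D * D := by
    refine (card_union_le _ _).trans (Nat.add_le_add ((card_union_le _ _).trans ?_) c1)
    rw [card_singleton]
    exact Nat.add_le_add_left hdw 1
  calc (#(lowDeg G H K) : ℝ) ≤ _ := Nat.cast_le.2 ((card_le_card hsub).trans (card_union_le _ _))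
    _ ≤ _ := by
      push_cast
      have : (#({w} ∪ univ.filter (G.Adj w) ∪
        (Hᶜ.filter (G.Adj w)).biUnion (fun a => univ.filter (G.Adj a))) : ℝ) ≤ 1 + D + D * D := by
          exact_mod_cast c3
      linarith

theorem card_lowDeg_filter_le {D : ℕ} {H K : Finset V} (hG : Admissible G D H) (hKH : K ⊆ H)
    (hK : ∀ w, w ∉ H → ∃ k ∈ K, G.Adj w k) (j : ℕ) :
    #((lowDeg G H K).filter fun v => degIn G H v = #K + j) ≤ #(maxIndep G (farFrom G H K) j) := by
  have hN : ∀ v ∈ lowDeg G H K, ∀ u, G.Adj v u → u ∈ H := by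
    intro v hv u hvu
    by_contra hu
    obtain ⟨k, hk, huk⟩ := hK u hu
    exact hG.noTriangle v u k hvu ((mem_lowDeg.1 hv).2.1 k hk) huk
  refine card_le_card_of_injOn (fun v => H.filter (G.Adj v) \ K) ?_ ?_
  · intro v hv
    obtain ⟨hv, hvj⟩ := mem_filter.1 hv
    obtain ⟨h1, h2, h3⟩ := mem_lowDeg.1 hv
    refine mem_maxIndep.2 ⟨?_, ?_, ?_, ?_⟩
    · intro u hu
      obtain ⟨h4, h5⟩ := mem_sdiff.1 hu
      obtain ⟨h6, h7⟩ := mem_filter.1 h4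
      exact mem_farFrom.2 ⟨h6, h5, fun k hk => hG.noTriangle v u k h7 (h2 k hk)⟩
    · rw [card_sdiff_of_subset fun k hk => mem_filter.2 ⟨hKH hk, h2 k hk⟩]
      rw [degIn] at hvj
      lia
    · intro a ha b hb
      exact hG.noTriangle v a b (mem_filter.1 (mem_sdiff.1 ha).1).2
        (mem_filter.1 (mem_sdiff.1 hb).1).2
    · intro u hu hu'
      obtain ⟨h4, h5, h6⟩ := mem_farFrom.1 hu
      have hvu : ¬ G.Adj v u := fun h => hu' (mem_sdiff.2 ⟨mem_filter.2 ⟨h4, h⟩, h5⟩)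
      obtain ⟨r, hr, hru⟩ := hG.diam v u (fun h => h1 (h ▸ h4)) hvu
      exact ⟨r, mem_sdiff.2 ⟨mem_filter.2 ⟨hN v hv r hr, hr⟩, fun h => h6 r h hru.symm⟩, hru.symm⟩
  · intro v hv v' hv' hvv
    obtain ⟨hv, -⟩ := mem_filter.1 hv
    obtain ⟨hv', -⟩ := mem_filter.1 hv'
    by_contra hne
    have aux : ∀ v ∈ lowDeg G H K, ∀ v' ∈ lowDeg G H K,
        H.filter (G.Adj v) \ K = H.filter (G.Adj v') \ K → ∀ w, G.Adj v w → G.Adj v' w := by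
      intro v hv v' hv' hvv w hw
      by_cases hwK : w ∈ K
      · exact (mem_lowDeg.1 hv').2.1 w hwK
      · have h8 : w ∈ H.filter (G.Adj v) \ K :=
          mem_sdiff.2 ⟨mem_filter.2 ⟨hN v hv w hw, hw⟩, hwK⟩
        rw [hvv] at h8
        exact (mem_filter.1 (mem_sdiff.1 h8).1).2
    obtain ⟨w, hw, hwv⟩ := hG.twin v v' hne
      fun w => ⟨aux v hv v' hv' hvv w, aux v' hv' v hv hvv.symm w⟩
    exact hw (hN v hv w hwv.symm)

theorem card_le_degIn_of_mem_lowDeg {H K : Finset V} (hKH : K ⊆ H) {v : V}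
    (hv : v ∈ lowDeg G H K) : #K ≤ degIn G H v :=
  card_le_card fun k hk => mem_filter.2 ⟨hKH hk, (mem_lowDeg.1 hv).2.1 k hk⟩

theorem card_lowDeg_le_sum {D : ℕ} {H K : Finset V} (hG : Admissible G D H) (hKH : K ⊆ H)
    (hK : ∀ w, w ∉ H → ∃ k ∈ K, G.Adj w k) (m : ℕ) :
    #((lowDeg G H K).filter fun v => degIn G H v < #K + m) ≤
      ∑ j ∈ range m, #(maxIndep G (farFrom G H K) j) := by
  calc #((lowDeg G H K).filter fun v => degIn G H v < #K + m) ≤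
      #((range m).biUnion fun j => (lowDeg G H K).filter fun v => degIn G H v = #K + j) := by
        refine card_le_card fun v hv => ?_
        obtain ⟨h1, h2⟩ := mem_filter.1 hv
        have h3 := card_le_degIn_of_mem_lowDeg hKH h1
        exact mem_biUnion.2 ⟨degIn G H v - #K, mem_range.2 (by lia),
          mem_filter.2 ⟨h1, by lia⟩⟩
    _ ≤ _ := card_biUnion_le
    _ ≤ _ := sum_le_sum fun j _ => card_lowDeg_filter_le hG hKH hK j

end LowDegree

section LowerBound

open scoped Classical
open Finset

/-- A bound, small compared with the number of edges inside `H`, for the number of vertices of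
small degree adjacent to a given set of `k` vertices of `H`. -/
def LowBound (D k : ℕ) : Prop :=
  ∀ η : ℝ, 0 < η → ∃ C : ℝ, 0 ≤ C ∧ ∀ (V : Type) [Fintype V] (G : SimpleGraph V) (H : Finset V),
    Admissible G D H → ∀ K ⊆ H, #K = k → (#(lowDeg G H K) : ℝ) ≤ η * degSum G H + C

theorem card_lowDeg_le_of_forall_insert {V : Type} [Fintype V] {G : SimpleGraph V} {D : ℕ}
    {H K : Finset V} (hG : Admissible G D H) {w : V} (hw : w ∉ H) (hwK : ∀ k ∈ K, ¬ G.Adj w k)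
    {η C : ℝ} (hη : 0 < η) (hC : 0 ≤ C)
    (hb : ∀ a ∈ H, a ∉ K → (#(lowDeg G H (insert a K)) : ℝ) ≤ η / (D + 1) * degSum G H + C) :
    (#(lowDeg G H K) : ℝ) ≤ η * degSum G H + (1 + D + D * D + D * C) := by
  have h := card_lowDeg_le_of_far hG hw hwK (by positivity) hb
  have h1 : (D : ℝ) * (η / (D + 1) * degSum G H) ≤ η * degSum G H := by
    rw [← mul_assoc]
    gcongr
    rw [mul_div_assoc', div_le_iff₀ (by positivity)]
    nlinarith
  linarith

theorem sum_card_maxIndep_le {η C₂ C₃ : ℝ} (hη : 0 < η) {V : Type} {G : SimpleGraph V}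
    (hG : NoTriangle G) {H F : Finset V} (hF : F ⊆ H)
    (h₂ : (#(maxIndep G F 2) : ℝ) ≤ η * degSum G F + C₂)
    (h₃ : (#(maxIndep G F 3) : ℝ) ≤ η * degSum G F + C₃) {m : ℕ} (hm : m ≤ 4) :
    (∑ j ∈ range m, #(maxIndep G F j) : ℕ) ≤ 2 * η * degSum G H + (3 + C₂ + C₃) := by
  have h0 : (#(maxIndep G F 0) : ℝ) ≤ 1 := by exact_mod_cast card_maxIndep_zero F
  have h1 : (#(maxIndep G F 1) : ℝ) ≤ 2 := by exact_mod_cast card_maxIndep_one hG F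
  have hE : η * degSum G F ≤ η * degSum G H := by
    gcongr
    exact degSum_mono hF
  calc ((∑ j ∈ range m, #(maxIndep G F j) : ℕ) : ℝ)
      ≤ (∑ j ∈ range 4, #(maxIndep G F j) : ℕ) := by
        exact_mod_cast sum_le_sum_of_subset (range_subset_range.2 hm)
    _ ≤ _ := by
        simp only [sum_range_succ, range_zero, sum_empty]
        push_cast
        linarith

theorem lowBound_of_succ {D k : ℕ} (hk : 2 ≤ k) (h : LowBound D (k + 1)) : LowBound D k := by
  intro η hη
  obtain ⟨C₁, hC₁, h₁⟩ := h (η / (D + 1)) (by positivity)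
  obtain ⟨C₂, hC₂, h₂⟩ := exists_card_maxIndep_two_le (half_pos hη)
  obtain ⟨C₃, hC₃, h₃⟩ := exists_card_maxIndep_three_le (half_pos hη)
  refine ⟨(1 + D + D * D + D * C₁) + (3 + C₂ + C₃), by positivity, ?_⟩
  intro V _ G H hG K hKH hK
  by_cases hfar : ∃ w, w ∉ H ∧ ∀ k ∈ K, ¬ G.Adj w k
  · obtain ⟨w, hw, hwK⟩ := hfar
    have := card_lowDeg_le_of_forall_insert hG hw hwK hη hC₁ fun a ha haK =>
      h₁ V G H hG _ (insert_subset ha hKH) (by rw [card_insert_of_notMem haK, hK])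
    linarith
  · push Not at hfar
    have e : (lowDeg G H K).filter (fun v => degIn G H v < #K + (6 - k)) = lowDeg G H K := by
      refine filter_true_of_mem fun v hv => ?_
      have := (mem_lowDeg.1 hv).2.2
      lia
    have h4 := card_lowDeg_le_sum hG hKH hfar (6 - k)
    rw [e] at h4
    have h5 := sum_card_maxIndep_le (half_pos hη) hG.noTriangle (filter_subset _ H)
      (h₂ V G hG.noTriangle (farFrom G H K)) (h₃ V G hG.noTriangle _) (show 6 - k ≤ 4 by lia)
    have h6 : (#(lowDeg G H K) : ℝ) ≤ _ := (Nat.cast_le.2 h4).trans h5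
    have : 0 ≤ 1 + D + D * D + D * C₁ := by positivity
    linarith

theorem lowBound_two (D : ℕ) : LowBound D 2 := by
  have h6 : LowBound D 6 := by
    intro η hη
    refine ⟨0, le_rfl, fun V _ G H hG K hKH hK => ?_⟩
    have : lowDeg G H K = ∅ := by
      refine eq_empty_of_forall_notMem fun v hv => ?_
      have h1 := card_le_degIn_of_mem_lowDeg hKH hv
      have h2 := (mem_lowDeg.1 hv).2.2
      lia
    rw [this, card_empty]
    simp only [Nat.cast_zero]
    positivity
  exact lowBound_of_succ le_rfl (lowBound_of_succ (by simp) (lowBound_of_succ (by simp)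
    (lowBound_of_succ (by simp) h6)))

theorem exists_edges_ge (D : ℕ) {η : ℝ} (hη : 0 < η) (hη1 : η ≤ 1 / 24) : ∃ C : ℝ, 0 ≤ C ∧
    ∀ (V : Type) [Fintype V] (G : SimpleGraph V) (H : Finset V), Admissible G D H →
      (17 / 3 - 17 * η) * (#Hᶜ : ℝ) - C ≤ G.edgeSet.ncard := by
  obtain ⟨C₁, hC₁, h₁⟩ := lowBound_two D (η / (D + 1) / (D + 1)) (by positivity)
  obtain ⟨C₂, hC₂, h₂⟩ := exists_card_maxIndep_two_le hη
  obtain ⟨C₃, hC₃, h₃⟩ := exists_card_maxIndep_three_le hη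
  obtain ⟨C₄, hC₄, h₄⟩ := exists_card_maxIndep_four_le hη
  set B : ℝ := 1 + D + D * D + D * (1 + D + D * D + D * C₁) with hB
  have hB0 : 0 ≤ B := by positivity
  refine ⟨6 * B + 6 * (3 + C₂ + C₃) + C₄, by positivity, fun V _ G H hG => ?_⟩
  have hsum : 2 * (∑ v ∈ Hᶜ, (degIn G H v : ℝ)) + degSum G H ≤ 2 * G.edgeSet.ncard := by
    exact_mod_cast sum_degIn_compl_le G H
  have hE : (0 : ℝ) ≤ degSum G H := by positivity
  by_cases hx : ∃ x ∈ H, ∀ w, w ∉ H → G.Adj w x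
  · obtain ⟨x, hxH, hx⟩ := hx
    have hKH : {x} ⊆ H := singleton_subset_iff.2 hxH
    have hK : ∀ w, w ∉ H → ∃ k ∈ ({x} : Finset V), G.Adj w k :=
      fun w hw => ⟨x, mem_singleton_self x, hx w hw⟩
    set F := farFrom G H {x} with hF
    have hFH : F ⊆ H := filter_subset _ H
    have hlow : ∀ v ∈ Hᶜ, degIn G H v ≤ 5 → v ∈ lowDeg G H {x} := fun v hv h5 =>
      mem_lowDeg.2 ⟨mem_compl.1 hv, fun k hk => by
        rw [mem_singleton.1 hk]; exact hx v (mem_compl.1 hv), h5⟩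
    set P := Hᶜ.filter fun v => degIn G H v = 5 with hP
    set Q := Hᶜ.filter fun v => degIn G H v < 5 with hQ
    have hPle : #P ≤ #(maxIndep G F 4) := by
      refine le_trans (card_le_card ?_) (card_lowDeg_filter_le hG hKH hK 4)
      intro v hv
      obtain ⟨h5, h6⟩ := mem_filter.1 hv
      exact mem_filter.2 ⟨hlow v h5 h6.le, by simpa using h6⟩
    have hQle : #Q ≤ ∑ j ∈ range 4, #(maxIndep G F j) := by
      refine le_trans (card_le_card ?_) (card_lowDeg_le_sum hG hKH hK 4)
      intro v hv
      obtain ⟨h5, h6⟩ := mem_filter.1 hv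
      exact mem_filter.2 ⟨hlow v h5 h6.le, by simpa using h6⟩
    have hQle' : (#Q : ℝ) ≤ _ := (Nat.cast_le.2 hQle).trans
      (sum_card_maxIndep_le hη hG.noTriangle hFH (h₂ V G hG.noTriangle F)
        (h₃ V G hG.noTriangle F) le_rfl)
    have h4 := h₄ V G hG.noTriangle F
    have hEF : (degSum G F : ℝ) ≤ degSum G H := by exact_mod_cast degSum_mono hFH
    have hPE : (4 / 3 - η) * (#P : ℝ) ≤ degSum G H + C₄ := by
      have : (#P : ℝ) ≤ #(maxIndep G F 4) := by exact_mod_cast hPle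
      nlinarith
    have hPL : (#P : ℝ) ≤ #Hᶜ := by exact_mod_cast card_filter_le _ _
    have hdeg : 6 * (#Hᶜ : ℝ) - #P - 6 * #Q ≤ ∑ v ∈ Hᶜ, (degIn G H v : ℝ) := by
      have : ∀ v ∈ Hᶜ, (6 : ℝ) - (if degIn G H v = 5 then 1 else 0) -
          6 * (if degIn G H v < 5 then 1 else 0) ≤ degIn G H v := by
        intro v _
        rcases lt_trichotomy (degIn G H v) 5 with h | h | h
        · rw [if_neg h.ne, if_pos h]; norm_num
        · rw [if_pos h, if_neg (by lia), h]; norm_num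
        · rw [if_neg h.ne', if_neg (by lia)]
          have : (6 : ℝ) ≤ degIn G H v := by exact_mod_cast h
          linarith
      refine le_trans (le_of_eq ?_) (sum_le_sum this)
      rw [sum_sub_distrib, sum_sub_distrib, sum_const, ← mul_sum, sum_boole, sum_boole,
        nsmul_eq_mul]
      ring
    have hP0 : (0 : ℝ) ≤ #P := by positivity
    nlinarith [mul_nonneg hη.le hP0, mul_nonneg hη.le hC₄,
      mul_le_mul_of_nonneg_left hPE (show 0 ≤ 1 - 12 * η by linarith),
      mul_nonneg (mul_nonneg hη.le hη.le) hP0, mul_nonneg hη.le hE]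
  · push Not at hx
    rcases Hᶜ.eq_empty_or_nonempty with hempty | ⟨w, hw⟩
    · rw [hempty, card_empty, Nat.cast_zero, mul_zero]
      have : (0 : ℝ) ≤ G.edgeSet.ncard := by positivity
      linarith
    have hlow : (#(lowDeg G H ∅) : ℝ) ≤ η * degSum G H + B := by
      refine card_lowDeg_le_of_forall_insert hG (mem_compl.1 hw) (by simp) hη (by positivity) ?_
      intro a ha _
      obtain ⟨w', hw', hadj⟩ := hx a ha
      refine card_lowDeg_le_of_forall_insert hG hw' (by simpa using hadj) (by positivity) hC₁ ?_
      intro b hb hba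
      refine h₁ V G H hG _ (insert_subset hb (insert_subset ha (empty_subset _))) ?_
      rw [card_insert_of_notMem hba, card_insert_of_notMem (notMem_empty a), card_empty]
    have hdeg : 6 * (#Hᶜ : ℝ) - 6 * #(lowDeg G H ∅) ≤ ∑ v ∈ Hᶜ, (degIn G H v : ℝ) := by
      have : ∀ v ∈ Hᶜ, (6 : ℝ) - 6 * (if degIn G H v ≤ 5 then 1 else 0) ≤ degIn G H v := by
        intro v _
        by_cases h : degIn G H v ≤ 5
        · rw [if_pos h]; norm_num
        · rw [if_neg h]
          have : (6 : ℝ) ≤ degIn G H v := by exact_mod_cast not_le.1 h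
          linarith
      refine le_trans (le_of_eq ?_) (sum_le_sum this)
      rw [sum_sub_distrib, sum_const, ← mul_sum, sum_boole, nsmul_eq_mul]
      have : Hᶜ.filter (fun v => degIn G H v ≤ 5) = lowDeg G H ∅ := by
        ext v
        simp [mem_lowDeg]
      rw [this]
      ring
    have hL : (0 : ℝ) ≤ #Hᶜ := by positivity
    nlinarith [mul_nonneg hη.le hE]

theorem noTriangle_of_cliqueFree {V : Type*} {G : SimpleGraph V} (h : G.CliqueFree 3) :
    NoTriangle G := fun a b c hab hac hbc =>
  h {a, b, c} (is3Clique_triple_iff.2 ⟨hab, hac, hbc⟩)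

theorem exists_common_neighbor_of_ksat {V : Type*} {G : SimpleGraph V} (h : Ksat 3 G) {u v : V}
    (huv : u ≠ v) (hadj : ¬ G.Adj u v) : ∃ w, G.Adj u w ∧ G.Adj w v := by
  by_contra! hno
  refine h.2 u v huv hadj fun s hs => ?_
  obtain ⟨a, b, c, hab, hac, hbc, rfl⟩ := is3Clique_iff.1 hs
  have hT := noTriangle_of_cliqueFree h.1
  simp only [sup_adj, fromEdgeSet_adj, Set.mem_singleton_iff, Sym2.eq_iff] at hab hac hbc
  have s1 : ∀ {x y}, G.Adj x y → G.Adj y x := fun h => h.symm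
  rcases hab with hab | ⟨⟨rfl, rfl⟩ | ⟨rfl, rfl⟩, hab'⟩ <;>
  rcases hac with hac | ⟨⟨h1, h2⟩ | ⟨h1, h2⟩, hac'⟩ <;>
  rcases hbc with hbc | ⟨⟨h3, h4⟩ | ⟨h3, h4⟩, hbc'⟩ <;>
  grind [NoTriangle]

/-- The lower bound for saturated graphs whose twins have a common neighbour of small degree. -/
theorem exists_edges_ge_of_ksat {t : ℕ} (ht : t ≤ 5) {ε : ℝ} (hε : 0 < ε) :
    ∃ N : ℕ, ∀ n : ℕ, N ≤ n → ∀ (V : Type) [Fintype V] (G : SimpleGraph V), Fintype.card V = n →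
      Ksat 3 G → TwinCond G t → ((17 : ℝ) / 3 - ε) * n ≤ (G.edgeSet.ncard : ℝ) := by
  obtain ⟨η, hη, hη1, hηε⟩ : ∃ η : ℝ, 0 < η ∧ η ≤ 1 / 24 ∧ 17 * η ≤ ε / 3 :=
    ⟨min (1 / 24) (ε / 51), by positivity, min_le_left _ _, by
      have := min_le_right (1 / 24) (ε / 51); linarith⟩
  obtain ⟨D, hD⟩ := exists_nat_gt (5 + 204 / ε)
  have hD5 : 5 ≤ D := by
    have : (5 : ℝ) < D := lt_trans (by have : 0 < 204 / ε := by positivity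
                                       linarith) hD
    exact_mod_cast this.le
  have hDε : 204 ≤ ε * D := by
    have : 204 / ε ≤ D := by linarith
    rw [div_le_iff₀ hε] at this
    linarith
  obtain ⟨C, hC, hmain⟩ := exists_edges_ge D hη hη1
  obtain ⟨N, hN⟩ := exists_nat_gt (3 * C / ε)
  refine ⟨N, fun n hn V _ G hV hsat htwin => ?_⟩
  have hNn : 3 * C ≤ ε * n := by
    have : 3 * C / ε ≤ n := hN.le.trans (by exact_mod_cast hn)
    rw [div_le_iff₀ hε] at this
    linarith
  by_contra! hlt
  set H : Finset V := univ.filter fun v => D < degIn G univ v with hH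
  have hadm : Admissible G D H := by
    refine ⟨noTriangle_of_cliqueFree hsat.1, fun u v => exists_common_neighbor_of_ksat hsat, ?_, ?_⟩
    · intro u v huv h
      obtain ⟨w, hw, hwu, -⟩ := htwin u v huv (Set.ext h)
      refine ⟨w, fun hwH => ?_, hwu⟩
      have := (mem_filter.1 hwH).2
      rw [degIn_eq_ncard, hw] at this
      lia
    · intro v hv
      by_contra hd
      exact hv (mem_filter.2 ⟨mem_univ v, not_le.1 hd⟩)
  have h1 := hmain V G H hadm
  have h2 : #H + #Hᶜ = n := by rw [card_add_card_compl, hV]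
  have h2' : (#H : ℝ) + #Hᶜ = n := by exact_mod_cast h2
  have h3 : (#H : ℝ) * D ≤ 2 * G.edgeSet.ncard := by
    have : #H * D ≤ 2 * G.edgeSet.ncard := by
      rw [← degSum_univ, degSum, ← smul_eq_mul]
      refine (card_nsmul_le_sum H _ D fun v hv => (mem_filter.1 hv).2.le).trans ?_
      exact sum_le_sum_of_subset (subset_univ H)
    exact_mod_cast this
  have hn0 : (0 : ℝ) ≤ n := by positivity
  have h4 : (#H : ℝ) * D ≤ 12 * n := by nlinarith
  have h5 : 17 / 3 * (#H : ℝ) ≤ ε / 3 * n := by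
    have hh : (0 : ℝ) ≤ #H := by positivity
    nlinarith
  nlinarith

end LowerBound

section Incidence

open scoped Classical
open Finset

theorem ksat_three_of_diam {V : Type*} {G : SimpleGraph V} (h : NoTriangle G)
    (hd : ∀ u v, u ≠ v → ¬ G.Adj u v → ∃ w, G.Adj u w ∧ G.Adj w v) : Ksat 3 G := by
  refine ⟨fun s hs => ?_, fun u v huv hadj hfree => ?_⟩
  · obtain ⟨a, b, c, hab, hac, hbc, -⟩ := is3Clique_iff.1 hs
    exact h a b c hab hac hbc
  · obtain ⟨w, huw, hwv⟩ := hd u v huv hadj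
    refine hfree {u, v, w} (is3Clique_triple_iff.2 ⟨?_, Or.inl huw, Or.inl hwv.symm⟩)
    exact Or.inr ((fromEdgeSet_adj _).2 ⟨rfl, huv⟩)

/-- Point sets `S i` and curve sets `T i` which are the sides of maximal bicliques of an incidence
relation, five elements in all, such that every flag lies in one of these bicliques. -/
structure BicliqueSystem {Z M ι : Type} (I : Z → M → Prop) (S : ι → Finset Z)
    (T : ι → Finset M) : Prop where
  mem_left : ∀ i z, z ∈ S i ↔ ∀ m ∈ T i, I z m
  mem_right : ∀ i m, m ∈ T i ↔ ∀ z ∈ S i, I z m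
  card_add : ∀ i, #(S i) + #(T i) = 5
  injective : Function.Injective T
  cover : ∀ z m, I z m → ∃ i, z ∈ S i ∧ m ∈ T i
  exists_right : ∀ z, ∃ m, I z m
  exists_left : ∀ m, ∃ z, I z m
  sep_left : ∀ z z', z ≠ z' → ∃ m, I z m ∧ ¬ I z' m
  sep_right : ∀ m m', m ≠ m' → ∃ z, I z m ∧ ¬ I z m'
  far_left : ∀ z z', ∃ m, ¬ I z m ∧ ¬ I z' m
  far_right : ∀ m m', ∃ z, ¬ I z m ∧ ¬ I z m'
  deg_left : ∀ z, ∃ s : Finset M, 5 ≤ #s ∧ ∀ m ∈ s, ¬ I z m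
  deg_right : ∀ m, ∃ s : Finset Z, 5 ≤ #s ∧ ∀ z ∈ s, ¬ I z m
  five_le : ∃ s : Finset ι, 5 ≤ #s

variable {Z M ι : Type}

/-- The graph formed by an apex, the points, the curves and the bicliques: points are joined to
the curves which avoid them, bicliques to their elements and to the apex. -/
def bicliqueGraph (I : Z → M → Prop) (S : ι → Finset Z) (T : ι → Finset M) :
    SimpleGraph ((Unit ⊕ ι) ⊕ (Z ⊕ M)) where
  Adj
    | .inl (.inl _), .inl (.inr _) => True
    | .inl (.inr _), .inl (.inl _) => True
    | .inl (.inr i), .inr (.inl z) => z ∈ S i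
    | .inr (.inl z), .inl (.inr i) => z ∈ S i
    | .inl (.inr i), .inr (.inr m) => m ∈ T i
    | .inr (.inr m), .inl (.inr i) => m ∈ T i
    | .inr (.inl z), .inr (.inr m) => ¬ I z m
    | .inr (.inr m), .inr (.inl z) => ¬ I z m
    | _, _ => False
  symm := ⟨by rintro ((_ | _) | (_ | _)) ((_ | _) | (_ | _)) h <;> exact h⟩
  loopless := ⟨by rintro ((_ | _) | (_ | _)) h <;> exact h⟩

variable {I : Z → M → Prop} {S : ι → Finset Z} {T : ι → Finset M}

namespace BicliqueSystem

theorem noTriangle (h : BicliqueSystem I S T) : NoTriangle (bicliqueGraph I S T) := by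
  have h1 : ∀ i z m, z ∈ S i → m ∈ T i → I z m := fun i z m hz hm => (h.mem_left i z).1 hz m hm
  rintro ((_ | i) | (z | m)) ((_ | i') | (z' | m')) ((_ | i'') | (z'' | m'')) <;>
    simp only [bicliqueGraph] <;> grind

theorem diam (h : BicliqueSystem I S T) (u v : (Unit ⊕ ι) ⊕ (Z ⊕ M)) (huv : u ≠ v)
    (hadj : ¬ (bicliqueGraph I S T).Adj u v) :
    ∃ w, (bicliqueGraph I S T).Adj u w ∧ (bicliqueGraph I S T).Adj w v := by
  have hl : ∀ z, ∃ i, z ∈ S i := fun z => by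
    obtain ⟨m, hm⟩ := h.exists_right z
    obtain ⟨i, hi, -⟩ := h.cover z m hm
    exact ⟨i, hi⟩
  have hr : ∀ m, ∃ i, m ∈ T i := fun m => by
    obtain ⟨z, hz⟩ := h.exists_left m
    obtain ⟨i, -, hi⟩ := h.cover z m hz
    exact ⟨i, hi⟩
  have hzi : ∀ z i, z ∉ S i → ∃ m, m ∈ T i ∧ ¬ I z m := fun z i hz => by
    simpa using (h.mem_left i z).not.1 hz
  have hmi : ∀ m i, m ∉ T i → ∃ z, z ∈ S i ∧ ¬ I z m := fun m i hm => by
    simpa using (h.mem_right i m).not.1 hm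
  rcases u with ((_ | i) | (z | m)) <;> rcases v with ((_ | i') | (z' | m'))
  · exact absurd rfl huv
  · exact absurd trivial hadj
  · obtain ⟨i, hi⟩ := hl z'
    exact ⟨.inl (.inr i), trivial, hi⟩
  · obtain ⟨i, hi⟩ := hr m'
    exact ⟨.inl (.inr i), trivial, hi⟩
  · exact absurd trivial hadj
  · exact ⟨.inl (.inl ()), trivial, trivial⟩
  · obtain ⟨m, h1, h2⟩ := hzi z' i hadj
    exact ⟨.inr (.inr m), h1, h2⟩
  · obtain ⟨z, h1, h2⟩ := hmi m' i hadj
    exact ⟨.inr (.inl z), h1, h2⟩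
  · obtain ⟨i, hi⟩ := hl z
    exact ⟨.inl (.inr i), hi, trivial⟩
  · obtain ⟨m, h1, h2⟩ := hzi z i' hadj
    exact ⟨.inr (.inr m), h2, h1⟩
  · obtain ⟨m, h1, h2⟩ := h.far_left z z'
    exact ⟨.inr (.inr m), h1, h2⟩
  · obtain ⟨i, h1, h2⟩ := h.cover z m' (not_not.1 hadj)
    exact ⟨.inl (.inr i), h1, h2⟩
  · obtain ⟨i, hi⟩ := hr m
    exact ⟨.inl (.inr i), hi, trivial⟩
  · obtain ⟨z, h1, h2⟩ := hmi m i' hadj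
    exact ⟨.inr (.inl z), h2, h1⟩
  · obtain ⟨i, h1, h2⟩ := h.cover z' m (not_not.1 hadj)
    exact ⟨.inl (.inr i), h2, h1⟩
  · obtain ⟨z, h1, h2⟩ := h.far_right m m'
    exact ⟨.inr (.inl z), h1, h2⟩

theorem twinFree (h : BicliqueSystem I S T) : TwinFree (bicliqueGraph I S T) := by
  intro u v huv
  have hN : ∀ w, (bicliqueGraph I S T).Adj u w ↔ (bicliqueGraph I S T).Adj v w :=
    fun w => Set.ext_iff.1 huv w
  rcases u with ((_ | i) | (z | m)) <;> rcases v with ((_ | i') | (z' | m'))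
  · rfl
  · exact ((hN (.inl (.inr i'))).1 trivial).elim
  · obtain ⟨m, hm, -⟩ := h.far_left z' z'
    exact ((hN (.inr (.inr m))).2 hm).elim
  · obtain ⟨z, hz, -⟩ := h.far_right m' m'
    exact ((hN (.inr (.inl z))).2 hz).elim
  · exact ((hN (.inl (.inr i))).2 trivial).elim
  · rw [h.injective (Finset.ext fun m => hN (.inr (.inr m)))]
  · exact ((hN (.inl (.inl ()))).1 trivial).elim
  · exact ((hN (.inl (.inl ()))).1 trivial).elim
  · obtain ⟨m, hm, -⟩ := h.far_left z z
    exact ((hN (.inr (.inr m))).1 hm).elim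
  · exact ((hN (.inl (.inl ()))).2 trivial).elim
  · by_contra hne
    obtain ⟨m, h1, h2⟩ := h.sep_left z z' fun h => hne (h ▸ rfl)
    exact (hN (.inr (.inr m))).2 h2 h1
  · obtain ⟨m, hm, -⟩ := h.far_left z z
    exact ((hN (.inr (.inr m))).1 hm).elim
  · obtain ⟨z, hz, -⟩ := h.far_right m m
    exact ((hN (.inr (.inl z))).1 hz).elim
  · exact ((hN (.inl (.inl ()))).2 trivial).elim
  · obtain ⟨z, hz, -⟩ := h.far_right m m
    exact ((hN (.inr (.inl z))).1 hz).elim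
  · by_contra hne
    obtain ⟨z, h1, h2⟩ := h.sep_right m m' fun h => hne (h ▸ rfl)
    exact (hN (.inr (.inl z))).2 h2 h1

theorem neighborSet_inr (i : ι) : (bicliqueGraph I S T).neighborSet (.inl (.inr i)) =
    (insert (.inl (.inl ())) ((S i).disjSum (T i) |>.map .inr) :
      Finset ((Unit ⊕ ι) ⊕ (Z ⊕ M))) := by
  ext ((_ | j) | (z | m)) <;> simp [bicliqueGraph]

theorem ncard_neighborSet_inr (h : BicliqueSystem I S T) (i : ι) :
    ((bicliqueGraph I S T).neighborSet (.inl (.inr i))).ncard = 6 := by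
  rw [neighborSet_inr, Set.ncard_coe_finset, card_insert_of_notMem (by simp), card_map,
    card_disjSum, h.card_add]

theorem five_le_ncard_neighborSet [Finite Z] [Finite M] [Finite ι]
    (h : BicliqueSystem I S T)
    (v : (Unit ⊕ ι) ⊕ (Z ⊕ M)) :
    5 ≤ ((bicliqueGraph I S T).neighborSet v).ncard := by
  have key : ∀ {α : Type} (f : α ↪ (Unit ⊕ ι) ⊕ (Z ⊕ M)) (s : Finset α), 5 ≤ #s →
      (∀ a ∈ s, (bicliqueGraph I S T).Adj v (f a)) →
      5 ≤ ((bicliqueGraph I S T).neighborSet v).ncard := by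
    intro α f s hs hadj
    refine hs.trans ?_
    rw [← card_map f, ← Set.ncard_coe_finset]
    refine Set.ncard_le_ncard (fun w hw => ?_) (Set.toFinite _)
    obtain ⟨a, ha, rfl⟩ := mem_map.1 (mem_coe.1 hw)
    exact hadj a ha
  rcases v with ((_ | i) | (z | m))
  · obtain ⟨s, hs⟩ := h.five_le
    exact key (Function.Embedding.inr.trans .inl) s hs fun _ _ => trivial
  · rw [h.ncard_neighborSet_inr]
    simp
  · obtain ⟨s, hs, hs'⟩ := h.deg_left z
    exact key (Function.Embedding.inr.trans .inr) s hs hs'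
  · obtain ⟨s, hs, hs'⟩ := h.deg_right m
    exact key (Function.Embedding.inl.trans .inr) s hs hs'

end BicliqueSystem

theorem BicliqueSystem.ncard_edgeSet_le [Fintype Z] [Fintype M] [Fintype ι]
    (h : BicliqueSystem I S T) : (bicliqueGraph I S T).edgeSet.ncard ≤
      6 * Fintype.card ι + Fintype.card Z * Fintype.card M := by
  set G := bicliqueGraph I S T with hG
  have hsub : G.edgeFinset ⊆ (univ.biUnion fun i : ι => G.incidenceFinset (.inl (.inr i))) ∪
      univ.image fun p : Z × M => s(.inr (.inl p.1), .inr (.inr p.2)) := by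
    intro e he
    induction e using Sym2.ind with
    | _ u v =>
      rw [mem_edgeFinset, mem_edgeSet] at he
      rcases u with ((_ | i) | (z | m)) <;> rcases v with ((_ | i') | (z' | m')) <;>
        first
        | exact he.elim
        | exact mem_union_left _ (mem_biUnion.2 ⟨i, mem_univ _,
            (mem_incidenceFinset ..).2 ⟨he, Sym2.mem_mk_left _ _⟩⟩)
        | exact mem_union_left _ (mem_biUnion.2 ⟨i', mem_univ _,
            (mem_incidenceFinset ..).2 ⟨he, Sym2.mem_mk_right _ _⟩⟩)
        | exact mem_union_right _ (mem_image.2 ⟨(z, m'), mem_univ _, rfl⟩)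
        | exact mem_union_right _ (mem_image.2 ⟨(z', m), mem_univ _, Sym2.eq_swap⟩)
  rw [← coe_edgeFinset, Set.ncard_coe_finset]
  refine (card_le_card hsub).trans ((card_union_le _ _).trans (Nat.add_le_add ?_ ?_))
  · rw [mul_comm]
    refine card_biUnion_le_card_mul _ _ 6 fun i _ => ?_
    rw [card_incidenceFinset_eq_degree, ← card_neighborFinset_eq_degree, ← Set.ncard_coe_finset,
      coe_neighborFinset, h.ncard_neighborSet_inr]
  · refine card_image_le.trans ?_
    rw [card_univ, Fintype.card_prod]

/-- A biclique system yields a twin-free saturated graph of minimum degree at least five. -/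
theorem BicliqueSystem.exists_ksat [Fintype Z] [Fintype M] [Fintype ι]
    (h : BicliqueSystem I S T) {n : ℕ}
    (hn : 1 + Fintype.card ι + (Fintype.card Z + Fintype.card M) = n) :
    ∃ G : SimpleGraph (Fin n), Ksat 3 G ∧ MinDegGe G 5 ∧ TwinFree G ∧
      G.edgeSet.ncard ≤ 6 * Fintype.card ι + Fintype.card Z * Fintype.card M := by
  have e : Fin n ≃ (Unit ⊕ ι) ⊕ (Z ⊕ M) := (Fintype.equivFinOfCardEq (by simp [hn])).symm
  let f := Iso.comap e (bicliqueGraph I S T)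
  refine ⟨(bicliqueGraph I S T).comap e, ksat_three_of_diam ?_ ?_, ?_, ?_, ?_⟩
  · exact fun a b c => h.noTriangle (e a) (e b) (e c)
  · intro u v huv hadj
    obtain ⟨w, h1, h2⟩ := h.diam (e u) (e v) (e.injective.ne huv) hadj
    exact ⟨e.symm w, by simpa using h1, by simpa using h2⟩
  · intro v
    have : (((bicliqueGraph I S T).comap e).neighborSet v).ncard =
        ((bicliqueGraph I S T).neighborSet (e v)).ncard := Nat.card_congr (f.mapNeighborSet v)
    rw [this]
    exact h.five_le_ncard_neighborSet (e v)
  · intro u v huv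
    refine e.injective (h.twinFree _ _ (Set.ext fun w => ?_))
    simpa using Set.ext_iff.1 huv (e.symm w)
  · have : ((bicliqueGraph I S T).comap e).edgeSet.ncard =
        (bicliqueGraph I S T).edgeSet.ncard := Nat.card_congr f.mapEdgeSet
    rw [this]
    exact h.ncard_edgeSet_le

end Incidence

section Curves

open scoped Classical
open Finset

variable {F : Type} [Field F]

/-- The quadratic polynomial function with coefficients `c`. -/
def quad (c : F × F × F) (x : F) : F := c.1 + c.2.1 * x + c.2.2 * x ^ 2

/-- Quadratic and monic cubic polynomial functions. -/
def curve : (F × F × F) ⊕ (F × F × F) → F → F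
  | .inl c, x => quad c x
  | .inr c, x => x ^ 3 + quad c x

theorem quad_add (c d : F × F × F) (x : F) : quad (c + d) x = quad c x + quad d x := by
  simp only [quad, Prod.fst_add, Prod.snd_add]
  ring

theorem quad_sub (c d : F × F × F) (x : F) : quad (c - d) x = quad c x - quad d x := by
  simp only [quad, Prod.fst_sub, Prod.snd_sub]
  ring

theorem eq_zero_of_quad_eq_zero {c : F × F × F} {x y z : F} (hxy : x ≠ y) (hxz : x ≠ z)
    (hyz : y ≠ z) (hx : quad c x = 0) (hy : quad c y = 0) (hz : quad c z = 0) : c = 0 := by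
  obtain ⟨a, b, d⟩ := c
  simp only [quad] at hx hy hz
  have h1 : b + d * (x + y) = 0 := by
    apply mul_left_cancel₀ (sub_ne_zero.2 hxy)
    linear_combination hx - hy
  have h2 : b + d * (x + z) = 0 := by
    apply mul_left_cancel₀ (sub_ne_zero.2 hxz)
    linear_combination hx - hz
  have hd : d = 0 := by
    apply mul_left_cancel₀ (sub_ne_zero.2 hyz)
    linear_combination h1 - h2
  subst hd
  have hb : b = 0 := by linear_combination h1
  subst hb
  have ha : a = 0 := by linear_combination hx
  subst ha
  rfl

theorem eq_of_quad_eq {c d : F × F × F} {s : Finset F} (hs : 3 ≤ #s)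
    (h : ∀ x ∈ s, quad c x = quad d x) : c = d := by
  obtain ⟨x, y, z, hx, hy, hz, hxy, hxz, hyz⟩ := two_lt_card_iff.1 hs
  refine sub_eq_zero.1 (eq_zero_of_quad_eq_zero hxy hxz hyz ?_ ?_ ?_) <;>
    rw [quad_sub, h _ ‹_›, sub_self]

variable [Fintype F]

/-- The roots of the monic cubic polynomial with lower coefficients `c`. -/
noncomputable def cubicRoots (c : F × F × F) : Finset F :=
  univ.filter fun x => x ^ 3 + quad c x = 0

theorem mem_cubicRoots {c : F × F × F} {x : F} : x ∈ cubicRoots c ↔ x ^ 3 + quad c x = 0 := by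
  simp [cubicRoots]

theorem exists_cubicRoots_eq {s : Finset F} (hs : #s = 3) : ∃ c, cubicRoots c = s := by
  obtain ⟨x, y, z, -, -, -, rfl⟩ := card_eq_three.1 hs
  refine ⟨(-(x * y * z), x * y + y * z + z * x, -(x + y + z)), Finset.ext fun w => ?_⟩
  rw [mem_cubicRoots, show w ^ 3 + quad (-(x * y * z), x * y + y * z + z * x, -(x + y + z)) w =
    (w - x) * ((w - y) * (w - z)) by simp only [quad]; ring]
  simp [sub_eq_zero]

theorem card_cubicRoots_le (c : F × F × F) : #(cubicRoots c) ≤ 3 := by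
  by_contra! h
  obtain ⟨s, hs, hs3⟩ := exists_subset_card_eq h.le
  obtain ⟨d, rfl⟩ := exists_cubicRoots_eq hs3
  have : c = d := eq_of_quad_eq hs3.ge fun x hx => by
    have h1 := mem_cubicRoots.1 hx
    have h2 := mem_cubicRoots.1 (hs hx)
    linear_combination h2 - h1
  subst this
  lia

theorem eq_of_curve_eq (hF : 4 ≤ Fintype.card F) {m m' : (F × F × F) ⊕ (F × F × F)}
    (h : ∀ x, curve m x = curve m' x) : m = m' := by
  have hF' : 4 ≤ #(univ : Finset F) := hF
  have aux : ∀ c d : F × F × F, ¬ ∀ x, quad c x = x ^ 3 + quad d x := by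
    intro c d hcd
    have h1 : cubicRoots (d - c) = univ := eq_univ_of_forall fun x => by
      rw [mem_cubicRoots, quad_sub]
      linear_combination -(hcd x)
    have h2 := card_cubicRoots_le (d - c)
    rw [h1] at h2
    lia
  rcases m with c | c <;> rcases m' with d | d
  · exact congrArg _ (eq_of_quad_eq (by lia : 3 ≤ #(univ : Finset F)) fun x _ => h x)
  · exact (aux c d h).elim
  · exact (aux d c fun x => (h x).symm).elim
  · exact congrArg _ (eq_of_quad_eq (by lia : 3 ≤ #(univ : Finset F)) fun x _ =>
      add_left_cancel (h x))

/-- The points common to the quadratic `i.1` and the cubic `i.1 + i.2`. -/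
noncomputable def pencilPoints (i : (F × F × F) × (F × F × F)) : Finset (F × F) :=
  (cubicRoots i.2).image fun x => (x, quad i.1 x)

/-- The quadratic `i.1` together with the cubic `i.1 + i.2`. -/
noncomputable def pencilCurves (i : (F × F × F) × (F × F × F)) :
    Finset ((F × F × F) ⊕ (F × F × F)) :=
  {.inl i.1, .inr (i.1 + i.2)}

theorem mem_pencilPoints {i : (F × F × F) × (F × F × F)} {z : F × F} :
    z ∈ pencilPoints i ↔ ∀ m ∈ pencilCurves i, curve m z.1 = z.2 := by
  obtain ⟨x, y⟩ := z
  simp only [pencilPoints, pencilCurves, mem_image, mem_insert, mem_singleton, forall_eq_or_imp,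
    forall_eq, curve, mem_cubicRoots, quad_add, Prod.mk.injEq]
  constructor
  · rintro ⟨x, hx, rfl, rfl⟩
    exact ⟨rfl, by linear_combination hx⟩
  · rintro ⟨h1, h2⟩
    exact ⟨x, by linear_combination h2 - h1, rfl, h1⟩

theorem mem_pencilCurves {i : (F × F × F) × (F × F × F)} (hi : #(cubicRoots i.2) = 3)
    {m : (F × F × F) ⊕ (F × F × F)} :
    m ∈ pencilCurves i ↔ ∀ z ∈ pencilPoints i, curve m z.1 = z.2 := by
  constructor
  · exact fun hm z hz => mem_pencilPoints.1 hz m hm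
  · intro h
    have h' : ∀ x ∈ cubicRoots i.2, curve m x = quad i.1 x :=
      fun x hx => h _ (mem_image_of_mem _ hx)
    rcases m with c | c
    · rw [eq_of_quad_eq hi.ge h']
      exact mem_insert_self _ _
    · have : c = i.1 + i.2 := eq_of_quad_eq hi.ge fun x hx => by
        have h1 : x ^ 3 + quad c x = quad i.1 x := h' x hx
        have h2 := mem_cubicRoots.1 hx
        rw [quad_add]
        linear_combination h1 - h2
      rw [this]
      exact mem_insert_of_mem (mem_singleton_self _)

theorem exists_pencil_of_incident (hF : 3 ≤ Fintype.card F) {z : F × F}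
    {m : (F × F × F) ⊕ (F × F × F)} (h : curve m z.1 = z.2) :
    ∃ i : (F × F × F) × (F × F × F), #(cubicRoots i.2) = 3 ∧ z ∈ pencilPoints i ∧
      m ∈ pencilCurves i := by
  obtain ⟨x, y⟩ := z
  obtain ⟨s, hs, -, hs3⟩ := exists_subsuperset_card_eq (subset_univ {x})
    ((card_singleton x).trans_le (by simp : 1 ≤ 3)) hF
  obtain ⟨d, rfl⟩ := exists_cubicRoots_eq hs3
  have hx := singleton_subset_iff.1 hs
  have hx' := mem_cubicRoots.1 hx
  rcases m with c | c
  · exact ⟨(c, d), hs3, mem_image.2 ⟨x, hx, congrArg (x, ·) h⟩, mem_insert_self _ _⟩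
  · refine ⟨(c - d, d), hs3, mem_image.2 ⟨x, hx, congrArg (x, ·) ?_⟩, ?_⟩
    · have h1 : x ^ 3 + quad c x = y := h
      change quad (c - d) x = y
      rw [quad_sub]
      linear_combination h1 - hx'
    · simp [pencilCurves]

theorem bicliqueSystem_pencil (hF : 7 ≤ Fintype.card F)
    {A : Finset ((F × F × F) × (F × F × F))} (hA5 : 5 ≤ #A)
    (hA : ∀ i ∈ A, #(cubicRoots i.2) = 3)
    (hcover : ∀ (z : F × F) m, curve m z.1 = z.2 →
      ∃ i ∈ A, z ∈ pencilPoints i ∧ m ∈ pencilCurves i) :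
    BicliqueSystem (fun (z : F × F) m => curve m z.1 = z.2) (fun i : A => pencilPoints i.1)
      (fun i : A => pencilCurves i.1) := by
  have hq : ∀ a x : F, quad (a, 0, 0) x = a := fun a x => by simp [quad]
  have hU : 7 ≤ #(univ : Finset F) := hF
  have havoid : ∀ a b : F, ∃ y, a ≠ y ∧ b ≠ y := fun a b => by
    obtain ⟨y, hy⟩ : ((univ \ {a, b} : Finset F)).Nonempty := by
      rw [← card_pos]
      have h1 := le_card_sdiff {a, b} (univ : Finset F)
      have h2 := card_le_two (a := a) (b := b)
      lia
    simp only [mem_sdiff, mem_univ, true_and, mem_insert, mem_singleton, not_or] at hy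
    exact ⟨y, Ne.symm hy.1, Ne.symm hy.2⟩
  have herase : ∀ a : F, 5 ≤ #(univ.erase a) := fun a => by
    rw [card_erase_of_mem (mem_univ a)]
    lia
  constructor
  · exact fun i z => mem_pencilPoints
  · exact fun i m => mem_pencilCurves (hA i.1 i.2)
  · intro i
    rw [pencilPoints, card_image_of_injective _ fun x y h => congrArg Prod.fst h, hA i.1 i.2,
      pencilCurves, card_pair Sum.inl_ne_inr]
  · rintro ⟨⟨a, b⟩, hi⟩ ⟨⟨c, d⟩, hj⟩ h
    have h' : pencilCurves (a, b) = pencilCurves (c, d) := h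
    have h1 : Sum.inl a ∈ pencilCurves (c, d) := h' ▸ mem_insert_self _ _
    have h2 : Sum.inr (a + b) ∈ pencilCurves (c, d) :=
      h' ▸ mem_insert_of_mem (mem_singleton_self _)
    simp only [pencilCurves, mem_insert, mem_singleton, Sum.inl.injEq, Sum.inr.injEq,
      reduceCtorEq, or_false, false_or] at h1 h2
    subst h1
    simp [add_left_cancel h2]
  · intro z m h
    obtain ⟨i, hi, h1, h2⟩ := hcover z m h
    exact ⟨⟨i, hi⟩, h1, h2⟩
  · exact fun z => ⟨.inl (z.2, 0, 0), hq _ _⟩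
  · exact fun m => ⟨(0, curve m 0), rfl⟩
  · rintro ⟨x, y⟩ ⟨x', y'⟩ hne
    by_cases hy : y = y'
    · subst hy
      refine ⟨.inl (y - x, 1, 0), by simp [curve, quad], fun h => hne ?_⟩
      have h' : quad (y - x, 1, 0) x' = y := h
      simp only [quad] at h'
      rw [show x' = x by linear_combination h']
    · exact ⟨.inl (y, 0, 0), hq _ _, fun h => hy ((hq y x').symm.trans h)⟩
  · intro m m' hne
    by_contra! h
    exact hne (eq_of_curve_eq (by lia) fun x => (h (x, curve m x) rfl).symm)
  · intro z z'
    obtain ⟨a, h1, h2⟩ := havoid z.2 z'.2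
    exact ⟨.inl (a, 0, 0), fun h => h1 (h.symm.trans (hq _ _)),
      fun h => h2 (h.symm.trans (hq _ _))⟩
  · intro m m'
    obtain ⟨y, h1, h2⟩ := havoid (curve m 0) (curve m' 0)
    exact ⟨(0, y), h1, h2⟩
  · intro z
    refine ⟨(univ.erase z.2).image fun a => .inl (a, 0, 0), ?_, ?_⟩
    · rw [card_image_of_injective _ fun a b h => by simpa using h]
      exact herase _
    · intro m hm h
      obtain ⟨a, ha, rfl⟩ := mem_image.1 hm
      exact (mem_erase.1 ha).1 ((hq _ _).symm.trans h)
  · intro m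
    refine ⟨(univ.erase (curve m 0)).image fun y => (0, y), ?_, ?_⟩
    · rw [card_image_of_injective _ fun a b h => by simpa using h]
      exact herase _
    · intro z hz h
      obtain ⟨y, hy, rfl⟩ := mem_image.1 hz
      exact (mem_erase.1 hy).1 h.symm
  · exact ⟨univ, by simpa using hA5⟩

theorem choose_le_card_filter_cubicRoots : (Fintype.card F).choose 3 ≤
    #(univ.filter fun c : F × F × F => #(cubicRoots c) = 3) := by
  rw [← card_univ, ← card_powersetCard]
  refine (card_le_card fun s hs => ?_).trans (card_image_le (f := cubicRoots))
  obtain ⟨c, rfl⟩ := exists_cubicRoots_eq (mem_powersetCard.1 hs).2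
  exact mem_image_of_mem _ (mem_filter.2 ⟨mem_univ c, (mem_powersetCard.1 hs).2⟩)

theorem exists_ksat_of_field {q n : ℕ} (hF : Fintype.card F = q) (hq : 7 ≤ q)
    (hn : 6 * q ^ 5 ≤ n) (hn' : n ≤ q ^ 3 * q.choose 3) :
    ∃ G : SimpleGraph (Fin n), Ksat 3 G ∧ MinDegGe G 5 ∧ TwinFree G ∧
      G.edgeSet.ncard ≤ 6 * n + 2 * q ^ 5 := by
  have h3 : Fintype.card (F × F × F) = q ^ 3 := by
    simp only [Fintype.card_prod, hF]
    ring
  have hZ : Fintype.card (F × F) = q ^ 2 := by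
    simp only [Fintype.card_prod, hF]
    ring
  have hM : Fintype.card ((F × F × F) ⊕ (F × F × F)) = 2 * q ^ 3 := by
    rw [Fintype.card_sum, h3]
    ring
  choose! f hf using fun (p : (F × F) × ((F × F × F) ⊕ (F × F × F)))
    (h : curve p.2 p.1.1 = p.1.2) => exists_pencil_of_incident (by lia) h
  set A₀ := (univ.filter fun p : (F × F) × ((F × F × F) ⊕ (F × F × F)) =>
    curve p.2 p.1.1 = p.1.2).image f with hA₀
  set A₁ := (univ : Finset (F × F × F)) ×ˢ
    univ.filter fun c : F × F × F => #(cubicRoots c) = 3 with hA₁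
  have hsub : A₀ ⊆ A₁ := by
    intro i hi
    obtain ⟨p, hp, rfl⟩ := mem_image.1 hi
    exact mem_product.2 ⟨mem_univ _, mem_filter.2 ⟨mem_univ _, (hf p (mem_filter.1 hp).2).1⟩⟩
  have h0 : #A₀ ≤ 2 * q ^ 5 := by
    refine card_image_le.trans ((card_filter_le _ _).trans ?_)
    rw [card_univ, Fintype.card_prod, hZ, hM]
    exact le_of_eq (by ring)
  have h1 : n ≤ #A₁ := by
    rw [card_product, card_univ, h3]
    exact hn'.trans (Nat.mul_le_mul_left _ (hF ▸ choose_le_card_filter_cubicRoots))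
  have hp5 : 7 ^ 5 ≤ q ^ 5 := Nat.pow_le_pow_left hq 5
  have hp2 : q ^ 2 ≤ q ^ 5 := Nat.pow_le_pow_right (by lia) (by simp)
  have hp3 : q ^ 3 ≤ q ^ 5 := Nat.pow_le_pow_right (by lia) (by simp)
  obtain ⟨A, hA₀A, hAA₁, hA⟩ := exists_subsuperset_card_eq hsub
    (show #A₀ ≤ n - 1 - q ^ 2 - 2 * q ^ 3 by lia) (by lia)
  have hsys := bicliqueSystem_pencil (hF.symm ▸ hq) (A := A) (by lia)
    (fun i hi => (mem_filter.1 (mem_product.1 (hAA₁ hi)).2).2)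
    (fun z m h => ⟨f (z, m), hA₀A (mem_image_of_mem _ (mem_filter.2 ⟨mem_univ _, h⟩)),
      (hf (z, m) h).2⟩)
  obtain ⟨G, h2, h4, h5, h6⟩ := hsys.exists_ksat (n := n) (by
    rw [Fintype.card_coe, hZ, hM]
    lia)
  refine ⟨G, h2, h4, h5, h6.trans ?_⟩
  rw [Fintype.card_coe, hZ, hM]
  have : q ^ 2 * (2 * q ^ 3) = 2 * q ^ 5 := by ring
  lia

end Curves

section UpperBound

theorem exists_prime_pow_bounds {δ : ℝ} (hδ : 0 < δ) : ∃ N : ℕ, ∀ n : ℕ, N ≤ n →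
    ∃ q : ℕ, q.Prime ∧ 7 ≤ q ∧ (q ^ 5 : ℝ) ≤ δ * n ∧ n ≤ q ^ 3 * q.choose 3 := by
  obtain ⟨K, hK⟩ := exists_nat_gt (32 * 64 * 12 / δ + 7)
  refine ⟨K ^ 6, fun n hn => ?_⟩
  have hex : ∃ k : ℕ, 12 * n ≤ k ^ 6 := ⟨12 * n, Nat.le_self_pow (by simp) _⟩
  obtain ⟨k, hk⟩ : ∃ k, k = Nat.find hex := ⟨_, rfl⟩
  have hkn : 12 * n ≤ k ^ 6 := hk ▸ Nat.find_spec hex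
  have hKk : K ≤ k := by
    by_contra! h
    have := Nat.pow_lt_pow_left h (show 6 ≠ 0 by simp)
    lia
  have hKk' : (K : ℝ) ≤ k := by exact_mod_cast hKk
  have hpos : 0 < 32 * 64 * 12 / δ := by positivity
  have hk7 : 7 ≤ k := by
    have : (7 : ℝ) ≤ k := by linarith
    exact_mod_cast this
  have hδk : 32 * 64 * 12 ≤ δ * k := by
    have : 32 * 64 * 12 / δ ≤ k := by linarith
    rw [div_le_iff₀ hδ] at this
    linarith
  have hlt : (k - 1) ^ 6 < 12 * n := by
    have := Nat.find_min hex (m := k - 1) (by lia)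
    lia
  have h2 : k ^ 6 ≤ 64 * (12 * n) := by
    calc k ^ 6 ≤ (2 * (k - 1)) ^ 6 := Nat.pow_le_pow_left (by lia) 6
      _ = 64 * (k - 1) ^ 6 := by ring
      _ ≤ _ := by lia
  obtain ⟨q, hq, hkq, hq2⟩ := Nat.exists_prime_lt_and_le_two_mul k (by lia)
  refine ⟨q, hq, by lia, ?_, ?_⟩
  · have h2' : (k : ℝ) ^ 6 ≤ 64 * (12 * n) := by exact_mod_cast h2
    have h3 : (q : ℝ) ^ 5 ≤ 32 * k ^ 5 := by
      have : q ^ 5 ≤ 32 * k ^ 5 := (Nat.pow_le_pow_left hq2 5).trans (le_of_eq (by ring))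
      exact_mod_cast this
    have hk0 : (0 : ℝ) ≤ (k : ℝ) ^ 5 := by positivity
    nlinarith
  · have h4 : 12 * n ≤ q ^ 6 := hkn.trans (Nat.pow_le_pow_left hkq.le 6)
    obtain ⟨r, rfl⟩ : ∃ r, q = r + 2 := ⟨q - 2, by lia⟩
    have h5 : 6 * (r + 2).choose 3 = (r + 2) * (r + 1) * r := by
      have := Nat.descFactorial_eq_factorial_mul_choose (r + 2) 3
      simp [Nat.descFactorial, Nat.factorial] at this
      rw [← this]
      ring
    have h6 : (r + 2) ^ 3 ≤ 12 * (r + 2).choose 3 := by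
      have : 5 ≤ r := by lia
      nlinarith
    have h7 : (r + 2) ^ 6 = (r + 2) ^ 3 * (r + 2) ^ 3 := by ring
    have h8 := Nat.mul_le_mul_left ((r + 2) ^ 3) h6
    lia

/-- Twin-free saturated graphs of minimum degree at least five with few edges. -/
theorem exists_ksat_edges_le {ε : ℝ} (hε : 0 < ε) : ∃ N : ℕ, ∀ n : ℕ, N ≤ n →
    ∃ G : SimpleGraph (Fin n), Ksat 3 G ∧ MinDegGe G 5 ∧ TwinFree G ∧
      (G.edgeSet.ncard : ℝ) ≤ (6 + ε) * n := by
  obtain ⟨N, hN⟩ := exists_prime_pow_bounds (δ := min (1 / 6) (ε / 2)) (by positivity)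
  refine ⟨N, fun n hn => ?_⟩
  obtain ⟨q, hq, hq7, hqn, hn'⟩ := hN n hn
  have := Fact.mk hq
  have hn0 : (0 : ℝ) ≤ n := by positivity
  have h1 := mul_le_mul_of_nonneg_right (min_le_left (1 / 6 : ℝ) (ε / 2)) hn0
  have h2 := mul_le_mul_of_nonneg_right (min_le_right (1 / 6 : ℝ) (ε / 2)) hn0
  have h3 : 6 * q ^ 5 ≤ n := by
    have : (6 : ℝ) * q ^ 5 ≤ n := by linarith
    exact_mod_cast this
  obtain ⟨G, hG, hdeg, htwin, hG'⟩ := exists_ksat_of_field (ZMod.card q) hq7 h3 hn'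
  refine ⟨G, hG, hdeg, htwin, ?_⟩
  have : (G.edgeSet.ncard : ℝ) ≤ 6 * n + 2 * q ^ 5 := by exact_mod_cast hG'
  linarith

end UpperBound

/-- For `1 ≤ t ≤ 5`:
`(17/3)n + o(n) ≤ tsat(n, K_3, t) ≤ 6n + o(n)`. -/
theorem stmt5 (t : ℕ) (ht1 : 1 ≤ t) (ht5 : t ≤ 5) (ε : ℝ) (hε : 0 < ε) :
    ∃ N : ℕ, ∀ n : ℕ, N ≤ n →
      (∀ (V : Type) [Fintype V] (G : SimpleGraph V), Fintype.card V = n →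
        Ksat 3 G → MinDegGe G t → TwinCond G t →
        ((17 : ℝ) / 3 - ε) * n ≤ (G.edgeSet.ncard : ℝ)) ∧
      (∃ G : SimpleGraph (Fin n), Ksat 3 G ∧ MinDegGe G t ∧ TwinCond G t ∧
        (G.edgeSet.ncard : ℝ) ≤ ((6 : ℝ) + ε) * n) := by
  obtain ⟨N₁, h₁⟩ := exists_edges_ge_of_ksat ht5 hε
  obtain ⟨N₂, h₂⟩ := exists_ksat_edges_le hε
  refine ⟨max N₁ N₂, fun n hn => ⟨fun V _ G hV hG _ htwin => ?_, ?_⟩⟩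
  · exact h₁ n (le_of_max_le_left hn) V G hV hG htwin
  · obtain ⟨G, hG, hdeg, htwin, hle⟩ := h₂ n (le_of_max_le_right hn)
    exact ⟨G, hG, fun v => ht5.trans (hdeg v), fun u v huv h => (huv (htwin u v h)).elim, hle⟩
end

section
/- For every integer r ≥ 3 there exists an integer M such that for every integer m ≥ M: every (r,r-2)-system (H,F) with |H| = m satisfies |F| ≤ 1; every (r,r-1)-system (H,F) with |H| = m satisfies |F| ≤ 2; moreover there exists an (r,r-2)-system with |H| = m and |F| = 1, and there exists an (r,r-1)-system with |H| = m and |F| = 2. -/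
open SimpleGraph

namespace SimpleGraph

lemma cliqueFreeOn_of_coloring {V : Type*} {H : SimpleGraph V} {s : Set V} {n : ℕ} (c : V → ℕ)
    (hc : ∀ u v, H.Adj u v → c u ≠ c v) (hn : 0 < n)
    (hs : ∀ v ∈ s, c v + 1 < n) : H.CliqueFreeOn s n := by
  intro t hts ht
  have hmaps : ∀ v ∈ t, c v ∈ Finset.range (n - 1) := fun v hv ↦ by
    have := hs v (hts hv)
    simp only [Finset.mem_range]
    omega
  have hinj : Set.InjOn c t := fun u hu v hv huv ↦ by
    by_contra hne
    exact hc u v (ht.isClique hu hv hne) huv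
  have hcard := Finset.card_le_card_of_injOn c hmaps hinj
  rw [ht.card_eq, Finset.card_range] at hcard
  omega

end SimpleGraph

lemma isRTSystem_iff {k t : ℕ} {V : Type*} [DecidableEq V] {H : SimpleGraph V}
    {F : Finset (Finset V)} :
    IsRTSystem (k + 2) t H F ↔ H.CliqueFree (k + 2) ∧
      (∀ S ∈ F, S.card = t ∧ H.CliqueFreeOn S (k + 1) ∧
        ∀ v ∉ S, ∃ s ⊆ insert v S, H.IsNClique (k + 1) s) ∧
      ∀ S ∈ F, ∀ T ∈ F, S ≠ T → ∃ s ⊆ S ∩ T, H.IsNClique k s := by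
  have key (S : Finset V) (n : ℕ) :
      ¬ H.CliqueFreeOn S n ↔ ∃ s ⊆ S, H.IsNClique n s := by
    simp [CliqueFreeOn]
  simp only [IsRTSystem, cliqueFree_induce_iff, key, Nat.add_sub_cancel,
    show k + 2 - 1 = k + 1 from rfl]

namespace IsRTSystem

variable {k : ℕ} {V : Type*} [DecidableEq V] {H : SimpleGraph V} {F : Finset (Finset V)}

lemma card_le_one (h : IsRTSystem (k + 2) k H F) : F.card ≤ 1 := by
  obtain ⟨-, hF, hpair⟩ := isRTSystem_iff.1 h
  refine Finset.card_le_one.2 fun S hS T hT ↦ ?_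
  by_contra hne
  obtain ⟨s, hs, hcl⟩ := hpair S hS T hT hne
  have hsS := Finset.eq_of_subset_of_card_le (hs.trans Finset.inter_subset_left)
    (by rw [hcl.card_eq, (hF S hS).1])
  have hsT := Finset.eq_of_subset_of_card_le (hs.trans Finset.inter_subset_right)
    (by rw [hcl.card_eq, (hF T hT).1])
  exact hne (hsS.symm.trans hsT)

lemma not_isClique (h : IsRTSystem (k + 2) (k + 1) H F) {S : Finset V} (hS : S ∈ F) :
    ¬ H.IsClique S := by
  obtain ⟨-, hF, -⟩ := isRTSystem_iff.1 h
  exact fun hcl ↦ (hF S hS).2.1 subset_rfl ⟨hcl, (hF S hS).1⟩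

lemma exists_isClique_insert_erase (h : IsRTSystem (k + 2) (k + 1) H F) {S : Finset V}
    (hS : S ∈ F) {v : V} (hv : v ∉ S) :
    ∃ w ∈ S, H.IsClique (insert v (S.erase w) : Finset V) := by
  obtain ⟨-, hF, -⟩ := isRTSystem_iff.1 h
  obtain ⟨hcard, hfree, hsat⟩ := hF S hS
  obtain ⟨s, hs, hcl⟩ := hsat v hv
  have hvs : v ∈ s := by
    by_contra hvs
    exact hfree (t := s) (by exact_mod_cast (Finset.subset_insert_iff_of_notMem hvs).1 hs) hcl
  obtain ⟨w, hwS, hws⟩ : ∃ w ∈ S, w ∉ s := by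
    by_contra! hSs
    have := Finset.card_le_card (Finset.insert_subset hvs hSs)
    rw [Finset.card_insert_of_notMem hv, hcl.card_eq, hcard] at this
    omega
  refine ⟨w, hwS, ?_⟩
  rw [← Finset.eq_of_subset_of_card_le (s := s) (t := insert v (S.erase w))]
  · exact hcl.isClique
  · intro x hx
    have := hs hx
    grind
  · rw [Finset.card_insert_of_notMem (by grind), Finset.card_erase_of_mem hwS, hcl.card_eq, hcard]
    omega

lemma inter_isNClique (h : IsRTSystem (k + 2) (k + 1) H F) {S T : Finset V} (hS : S ∈ F)
    (hT : T ∈ F) (hne : S ≠ T) : H.IsNClique k (S ∩ T) := by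
  obtain ⟨-, hF, hpair⟩ := isRTSystem_iff.1 h
  obtain ⟨s, hs, hcl⟩ := hpair S hS T hT hne
  rwa [← Finset.eq_of_subset_of_card_le hs]
  have hlt : (S ∩ T).card < k + 1 := by
    rw [← (hF S hS).1]
    refine Finset.card_lt_card (Finset.inter_subset_left.ssubset_of_ne fun heq ↦ hne ?_)
    exact Finset.eq_of_subset_of_card_le (Finset.inter_eq_left.1 heq)
      (by rw [(hF S hS).1, (hF T hT).1])
  rw [hcl.card_eq]
  omega

/-- Each member of a `(k + 2, k + 1)`-system extends its intersection with another member by one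
vertex. -/
lemma exists_eq_insert_inter (h : IsRTSystem (k + 2) (k + 1) H F) {S T : Finset V} (hS : S ∈ F)
    (hT : T ∈ F) (hne : S ≠ T) : ∃ x ∉ S ∩ T, S = insert x (S ∩ T) := by
  have hcard := (h.inter_isNClique hS hT hne).card_eq
  obtain ⟨x, hx, heq⟩ := (Finset.covBy_iff_exists_insert (s := S ∩ T) (t := S)).1
    (Finset.covBy_iff_card_sdiff_eq_one.2 ⟨Finset.inter_subset_left, by
      rw [Finset.card_sdiff_of_subset Finset.inter_subset_left, hcard,
        ((isRTSystem_iff.1 h).2.1 S hS).1]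
      omega⟩)
  exact ⟨x, hx, heq.symm⟩

/-- No three members of a `(k + 2, k + 1)`-system form a sunflower. -/
lemma inter_ne_inter (h : IsRTSystem (k + 2) (k + 1) H F) {S T U : Finset V} (hS : S ∈ F)
    (hT : T ∈ F) (hU : U ∈ F) (hST : S ≠ T) (hSU : S ≠ U) (hTU : T ≠ U) :
    S ∩ T ≠ S ∩ U := by
  intro heq
  have hC := h.inter_isNClique hS hT hST
  obtain ⟨x, hx, hSx⟩ := h.exists_eq_insert_inter hS hT hST
  obtain ⟨y, hy, hTy⟩ := h.exists_eq_insert_inter hT hS hST.symm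
  obtain ⟨z, hz, hUz⟩ := h.exists_eq_insert_inter hU hS hSU.symm
  rw [Finset.inter_comm] at hy hTy hz hUz
  rw [← heq] at hz hUz
  generalize S ∩ T = C at *
  have hnS := h.not_isClique hS
  have hnT := h.not_isClique hT
  have hnU := h.not_isClique hU
  obtain ⟨w, hw, hw'⟩ := h.exists_isClique_insert_erase hS (v := y) (by grind)
  obtain ⟨w₁, hw₁, hw₁'⟩ := h.exists_isClique_insert_erase hS (v := z) (by grind)
  obtain ⟨w₂, hw₂, hw₂'⟩ := h.exists_isClique_insert_erase hT (v := z) (by grind)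
  subst hSx hTy hUz
  have hwx : w ≠ x := by
    rintro rfl
    rw [Finset.erase_insert hx] at hw'
    exact hnT hw'
  have hw₁x : w₁ ≠ x := by
    rintro rfl
    rw [Finset.erase_insert hx] at hw₁'
    exact hnU hw₁'
  have hw₂y : w₂ ≠ y := by
    rintro rfl
    rw [Finset.erase_insert hy] at hw₂'
    exact hnU hw₂'
  have hCcl := hC.isClique
  have hww₁ : w = w₁ := by
    by_contra hne
    refine hnS fun a ha b hb hab ↦ ?_
    have := @hCcl a
    have := @hw' a
    have := @hw₁' a
    have := @hw' x
    have := @hw₁' x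
    grind [SimpleGraph.adj_comm]
  subst hww₁
  have hyz : H.Adj y z := hw₂' (by grind) (by grind) (by grind) |>.symm
  refine (isRTSystem_iff.1 h).1 (insert z (insert y (insert x (C.erase w)))) ⟨?_, ?_⟩
  · intro a ha b hb hab
    have := @hw' a
    have := @hw₁' a
    grind [SimpleGraph.adj_comm]
  · have hwC : w ∈ C := by grind
    have := Finset.card_pos.2 ⟨w, hwC⟩
    rw [Finset.card_insert_of_notMem (by grind), Finset.card_insert_of_notMem (by grind),
      Finset.card_insert_of_notMem (by grind), Finset.card_erase_of_mem hwC]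
    have := hC.card_eq
    omega

lemma inter_eq_inter (h : IsRTSystem (k + 2) (k + 1) H F) {S T U : Finset V} (hS : S ∈ F)
    (hT : T ∈ F) (hU : U ∈ F) (hST : S ≠ T) (hSU : S ≠ U) (hTU : T ≠ U) :
    S ∩ T = S ∩ U := by
  by_contra hne
  obtain ⟨b, hb, hSb⟩ := h.exists_eq_insert_inter hS hT hST
  obtain ⟨a, ha, hSa⟩ := h.exists_eq_insert_inter hS hU hSU
  obtain ⟨d, hd, hTd⟩ := h.exists_eq_insert_inter hT hS hST.symm
  obtain ⟨e, he, hUe⟩ := h.exists_eq_insert_inter hU hS hSU.symm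
  have hab : a ≠ b := by
    rintro rfl
    exact hne (by grind)
  have hST' := h.inter_isNClique hS hT hST
  have hTU' := h.inter_isNClique hT hU hTU
  have hSU' := h.inter_isNClique hS hU hSU
  have hdU : d ∈ U := by
    by_contra hdU
    have hlt : (T ∩ U).card < (S ∩ T).card :=
      Finset.card_lt_card ⟨by grind, fun hsub ↦ by
        have := @hsub a
        grind⟩
    rw [hST'.card_eq, hTU'.card_eq] at hlt
    omega
  obtain ⟨w, hw, hcl⟩ := h.exists_isClique_insert_erase hS (v := d) (by grind)
  have hwab : w = a ∨ w = b := by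
    by_contra! hwab
    have hST_mem : ∀ z ∈ S, z ≠ b → z ∈ S ∩ T := by grind
    have hSU_mem : ∀ z ∈ S, z ≠ a → z ∈ S ∩ U := by grind
    have hwd_mem : ∀ z ∈ S, z ≠ w → z ∈ insert d (S.erase w) := by grind
    refine h.not_isClique hS fun x hx y hy hxy ↦ ?_
    have h₁ := @hST'.isClique x
    have h₂ := @hSU'.isClique x
    have h₃ := @hcl x
    simp only [Finset.mem_coe] at hx hy h₁ h₂ h₃
    clear hSb hSa hTd hUe hne
    grind
  rcases hwab with rfl | rfl
  · exact h.not_isClique hU (by convert hcl using 2; grind)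
  · exact h.not_isClique hT (by convert hcl using 2; grind)

lemma card_le_two (h : IsRTSystem (k + 2) (k + 1) H F) : F.card ≤ 2 := by
  by_contra! hF
  obtain ⟨S, T, U, hS, hT, hU, hST, hSU, hTU⟩ := Finset.two_lt_card_iff.1 hF
  exact h.inter_ne_inter hS hT hU hST hSU hTU (h.inter_eq_inter hS hT hU hST hSU hTU)

end IsRTSystem

lemma Fin.card_univ_filter_val_lt {m k : ℕ} (hk : k ≤ m) :
    (Finset.univ.filter fun i : Fin m ↦ i.val < k).card = k := by
  simp [Fin.card_filter_val_lt, hk]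

lemma exists_isRTSystem_card_eq_one {k m : ℕ} (hm : k ≤ m) :
    ∃ (H : SimpleGraph (Fin m)) (F : Finset (Finset (Fin m))),
      IsRTSystem (k + 2) k H F ∧ F.card = 1 := by
  let H : SimpleGraph (Fin m) := .fromRel fun u v ↦ u.val < k
  let A : Finset (Fin m) := Finset.univ.filter fun i ↦ i.val < k
  have hA : A.card = k := Fin.card_univ_filter_val_lt hm
  have hcol (u v) (huv : H.Adj u v) : min u.val k ≠ min v.val k := by
    simp only [H, fromRel_adj, ne_eq, Fin.ext_iff] at huv
    omega
  refine ⟨H, {A}, isRTSystem_iff.2 ⟨?_, ?_, by simp⟩, by simp⟩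
  · rw [← cliqueFreeOn_univ]
    exact cliqueFreeOn_of_coloring _ hcol (by omega) (by simp)
  · simp only [Finset.mem_singleton, forall_eq]
    refine ⟨hA, cliqueFreeOn_of_card_lt H (by omega), fun v hv ↦ ⟨_, subset_rfl, ?_, ?_⟩⟩
    · intro a ha b hb hab
      simp only [H, A, fromRel_adj] at *
      grind
    · rw [Finset.card_insert_of_notMem hv, hA]

lemma exists_isRTSystem_card_eq_two {k m : ℕ} (hk : 1 ≤ k) (hm : k + 2 ≤ m) :
    ∃ (H : SimpleGraph (Fin m)) (F : Finset (Finset (Fin m))),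
      IsRTSystem (k + 2) (k + 1) H F ∧ F.card = 2 := by
  let H : SimpleGraph (Fin m) := .fromRel fun u v ↦ u < v ∧
    (u.val + 1 < k ∨ (u.val + 1 = k ∧ k + 2 ≤ v.val) ∨ (u.val = k ∧ v.val = k + 1))
  let A : Finset (Fin m) := Finset.univ.filter fun i ↦ i.val < k
  have hA : A.card = k := Fin.card_univ_filter_val_lt (by omega)
  let c : Fin m := ⟨k - 1, by omega⟩
  let x : Fin m := ⟨k, by omega⟩
  let y : Fin m := ⟨k + 1, by omega⟩
  have hc : c ∈ A := by simp [A, c]; omega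
  have hx : x ∉ A := by simp [A, x]
  have hy : y ∉ A := by simp [A, y]
  have hxy : x ≠ y := by simp [x, y]
  have hclA : H.IsClique A := by
    intro a ha b hb hab
    simp only [H, A, fromRel_adj, Finset.coe_filter, Set.mem_ofPred_eq, Finset.mem_univ,
      true_and, ne_eq, Fin.ext_iff, Fin.lt_def] at *
    omega
  have hcol₁ (u v) (huv : H.Adj u v) :
      (if u.val < k then u.val else if u.val = k then k - 1 else k) ≠
        (if v.val < k then v.val else if v.val = k then k - 1 else k) := by
    simp only [H, fromRel_adj, ne_eq, Fin.ext_iff, Fin.lt_def] at huv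
    grind
  have hcol₂ (u v) (huv : H.Adj u v) :
      (if u.val < k then u.val else if u.val = k + 1 then k - 1 else k) ≠
        (if v.val < k then v.val else if v.val = k + 1 then k - 1 else k) := by
    simp only [H, fromRel_adj, ne_eq, Fin.ext_iff, Fin.lt_def] at huv
    grind
  have hclB : H.IsClique (insert x (insert y (A.erase c)) : Finset (Fin m)) := by
    intro a ha b hb hab
    simp only [H, A, x, y, c, fromRel_adj, Finset.mem_coe, Finset.mem_insert, Finset.mem_erase,
      Finset.mem_filter, Finset.mem_univ, true_and, ne_eq, Fin.ext_iff, Fin.lt_def] at *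
    omega
  have hB : (insert x (insert y (A.erase c))).card = k + 1 := by
    rw [Finset.card_insert_of_notMem (by grind), Finset.card_insert_of_notMem (by grind),
      Finset.card_erase_of_mem hc]
    omega
  have hclv (v : Fin m) (hvA : v ∉ A) (hvx : v ≠ x) (hvy : v ≠ y) :
      H.IsNClique (k + 1) (insert v A) := by
    refine ⟨?_, by rw [Finset.card_insert_of_notMem hvA, hA]⟩
    rw [Finset.coe_insert, isClique_insert]
    refine ⟨hclA, fun b hb hne ↦ ?_⟩
    simp only [H, A, x, y, fromRel_adj, Finset.mem_coe, Finset.mem_filter, Finset.mem_univ,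
      true_and, ne_eq, Fin.ext_iff, Fin.lt_def] at *
    omega
  have hinter : insert x A ∩ insert y A = A := by grind
  have hne : insert x A ≠ insert y A := fun h ↦ by
    have := h ▸ Finset.mem_insert_self x A
    grind
  refine ⟨H, {insert x A, insert y A}, isRTSystem_iff.2 ⟨?_, ?_, ?_⟩, Finset.card_pair hne⟩
  · rw [← cliqueFreeOn_univ]
    refine cliqueFreeOn_of_coloring _ hcol₁ (by omega) fun v _ ↦ ?_
    grind
  · simp only [Finset.mem_insert, Finset.mem_singleton, forall_eq_or_imp, forall_eq]
    refine ⟨⟨by rw [Finset.card_insert_of_notMem hx, hA],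
        cliqueFreeOn_of_coloring _ hcol₁ (by omega) fun v hv ↦ ?_, fun v hv ↦ ?_⟩,
      ⟨by rw [Finset.card_insert_of_notMem hy, hA],
        cliqueFreeOn_of_coloring _ hcol₂ (by omega) fun v hv ↦ ?_, fun v hv ↦ ?_⟩⟩
    · simp only [A, x, Finset.mem_coe, Finset.mem_insert, Finset.mem_filter, Finset.mem_univ,
        true_and, Fin.ext_iff] at hv
      grind
    · by_cases hvy : v = y
      · exact ⟨_, by grind, hclB, hB⟩
      · exact ⟨_, by grind, hclv v (by grind) (by grind) hvy⟩
    · simp only [A, y, Finset.mem_coe, Finset.mem_insert, Finset.mem_filter, Finset.mem_univ,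
        true_and, Fin.ext_iff] at hv
      grind
    · by_cases hvx : v = x
      · exact ⟨_, by grind, hclB, hB⟩
      · exact ⟨_, by grind, hclv v (by grind) hvx (by grind)⟩
  · have hA' : H.IsNClique k A := ⟨hclA, hA⟩
    simp only [Finset.mem_insert, Finset.mem_singleton]
    rintro S (rfl | rfl) T (rfl | rfl) hST
    · exact absurd rfl hST
    · exact ⟨A, hinter.ge, hA'⟩
    · exact ⟨A, by rw [Finset.inter_comm]; exact hinter.ge, hA'⟩
    · exact absurd rfl hST

/-- For `r ≥ 3` and large `m`: `(r,r-2)`-systems on `m` vertices have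
`|F| ≤ 1`, `(r,r-1)`-systems have `|F| ≤ 2`, and both bounds are attained. -/
theorem stmt6 (r : ℕ) (hr : 3 ≤ r) :
    ∃ M : ℕ, ∀ m : ℕ, M ≤ m →
      (∀ (V : Type) [Fintype V] [DecidableEq V] (H : SimpleGraph V) (F : Finset (Finset V)),
        Fintype.card V = m → IsRTSystem r (r - 2) H F → F.card ≤ 1) ∧
      (∀ (V : Type) [Fintype V] [DecidableEq V] (H : SimpleGraph V) (F : Finset (Finset V)),
        Fintype.card V = m → IsRTSystem r (r - 1) H F → F.card ≤ 2) ∧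
      (∃ (H : SimpleGraph (Fin m)) (F : Finset (Finset (Fin m))),
        IsRTSystem r (r - 2) H F ∧ F.card = 1) ∧
      (∃ (H : SimpleGraph (Fin m)) (F : Finset (Finset (Fin m))),
        IsRTSystem r (r - 1) H F ∧ F.card = 2) := by
  obtain ⟨k, rfl⟩ : ∃ k, r = k + 2 := ⟨r - 2, by omega⟩
  rw [show k + 2 - 2 = k from rfl, show k + 2 - 1 = k + 1 from rfl]
  exact ⟨k + 2, fun m hm ↦ ⟨fun _ _ _ _ _ _ h ↦ h.card_le_one, fun _ _ _ _ _ _ h ↦ h.card_le_two,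
    exists_isRTSystem_card_eq_one (by omega), exists_isRTSystem_card_eq_two (by omega) hm⟩⟩
end
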